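/- arXiv:math/0310125 — 3 statements merged into one kernel-verified Lean document; each statement's English description precedes it below -/
import Mathlib

section
/- Let k be a subfield of a field f and let G be a subgroup of the multiplicative group f* such that k* ≤ G. Assume that the quotient group G/k* is torsion; that k contains a primitive 4th root of unity whenever G/k* has an element of order 4; that for every prime p lying both in π(t(G)) and in π(G/k*) the field k contains a primitive p-th root of unity; and that the characteristic of k does not belong to π(G/k*). Then k(G) = ⊕_{t ∈ T} k·t as a k-vector space, where T is any transversal to the subgroup k* in G; that is, k(G) is the direct sum of the one-dimensional k-subspaces k·t over a set T of coset representatives of k* in G. -/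
/-- The image of `Kˣ` in `Fˣ` under the algebra map, i.e. the subgroup `k*` of `f*`. -/
def fieldUnitsRange (K F : Type*) [Field K] [Field F] [Algebra K F] : Subgroup Fˣ :=
  (Units.map (algebraMap K F : K →+* F).toMonoidHom).range

open Polynomial in
theorem minpoly_eq_X_pow_sub_C_of_prime {K F : Type*} [Field K] [Field F] [Algebra K F]
    {p : ℕ} (hp : p.Prime) {y : F} {a : K} (hy : y ^ p = algebraMap K F a)
    (ha : ∀ b : K, b ^ p ≠ a) : minpoly K y = X ^ p - C a :=
  (minpoly.eq_of_irreducible_of_monic (X_pow_sub_C_irreducible_of_prime hp ha)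
    (by simp [hy]) (monic_X_pow_sub_C a hp.ne_zero)).symm

theorem isIntegral_of_pow_eq_algebraMap {K F : Type*} [Field K] [Field F] [Algebra K F]
    {n : ℕ} (hn : n ≠ 0) {y : F} {a : K} (hy : y ^ n = algebraMap K F a) : IsIntegral K y :=
  IsIntegral.of_pow (Nat.pos_of_ne_zero hn) (hy ▸ isIntegral_algebraMap)

open IntermediateField in
theorem finrank_adjoin_simple_of_pow_prime {K F : Type*} [Field K] [Field F] [Algebra K F]
    {p : ℕ} (hp : p.Prime) {y : F} {a : K} (hy : y ^ p = algebraMap K F a)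
    (ha : ∀ b : K, b ^ p ≠ a) : Module.finrank K K⟮y⟯ = p := by
  rw [adjoin.finrank (isIntegral_of_pow_eq_algebraMap hp.ne_zero hy),
    minpoly_eq_X_pow_sub_C_of_prime hp hy ha, Polynomial.natDegree_X_pow_sub_C]

open IntermediateField in
/-- The automorphism `y ↦ ζ y` of a Kummer extension of prime degree, with its eigenspaces. -/
theorem exists_kummer_algHom {K F : Type*} [Field K] [Field F] [Algebra K F]
    {p : ℕ} (hp : p.Prime) {y : F} {a : K} (hy : y ^ p = algebraMap K F a)
    (ha : ∀ b : K, b ^ p ≠ a) {ζ : K} (hζ : IsPrimitiveRoot ζ p) :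
    ∃ σ : K⟮y⟯ →ₐ[K] K⟮y⟯, (∀ x, σ^[p] x = x) ∧
      ∀ j < p, ∀ x, σ x = ζ ^ j • x → ∃ c : K, (x : F) = c • y ^ j := by
  have hyint := isIntegral_of_pow_eq_algebraMap hp.ne_zero hy
  have hmin := minpoly_eq_X_pow_sub_C_of_prime hp hy ha
  set g := AdjoinSimple.gen K y with hg
  have hgp : g ^ p = algebraMap K _ a := Subtype.ext (by simpa [hg] using hy)
  let pb := adjoin.powerBasis hyint
  have hgen : pb.gen = g := adjoin.powerBasis_gen hyint
  have hdim : pb.dim = p := by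
    rw [← pb.natDegree_minpoly, hgen, hg, minpoly_gen, hmin, Polynomial.natDegree_X_pow_sub_C]
  have hroot : Polynomial.aeval (ζ • g) (minpoly K pb.gen) = 0 := by
    rw [hgen, hg, minpoly_gen, hmin]
    simp [smul_pow, hζ.pow_eq_one, ← hg, hgp]
  let σ := pb.lift (ζ • g) hroot
  have hσg : σ g = ζ • g := by rw [← hgen, pb.lift_gen, hgen]
  have hσpow (i : ℕ) : σ (g ^ i) = ζ ^ i • g ^ i := by rw [map_pow, hσg, smul_pow]
  have hit (n : ℕ) : (σ ^ n) g = ζ ^ n • g := by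
    induction n with
    | zero => simp
    | succ n ih => rw [pow_succ, AlgHom.mul_apply, hσg, map_smul, ih, smul_smul, pow_succ']
  have hσp : σ ^ p = 1 := pb.algHom_ext (by rw [hgen, hit, hζ.pow_eq_one]; simp)
  refine ⟨σ, fun x ↦ ?_, fun j hj x hx ↦ ?_⟩
  · have := congr($hσp x)
    rwa [AlgHom.coe_pow] at this
  · have hb (i) : pb.basis i = g ^ (i : ℕ) := by rw [pb.basis_eq_pow, hgen]
    have h1 : ∑ i, (pb.basis.repr x i * ζ ^ (i : ℕ)) • pb.basis i
        = ∑ i, (pb.basis.repr x i * ζ ^ j) • pb.basis i := by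
      have h2 : σ x = ∑ i, (pb.basis.repr x i * ζ ^ (i : ℕ)) • pb.basis i := by
        conv_lhs => rw [← pb.basis.sum_repr x]
        simp [hb, hσpow, smul_smul]
      rw [← h2, hx]
      conv_lhs => rw [← pb.basis.sum_repr x]
      simp [Finset.smul_sum, smul_smul, mul_comm]
    have h3 (i) : pb.basis.repr x i * ζ ^ (i : ℕ) = pb.basis.repr x i * ζ ^ j := by
      have := congr(pb.basis.repr $h1 i)
      rwa [Module.Basis.repr_sum_self, Module.Basis.repr_sum_self] at this
    have h4 (i : Fin pb.dim) (hi : (i : ℕ) ≠ j) : pb.basis.repr x i = 0 := by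
      by_contra h0
      exact hi (hζ.pow_inj (hdim ▸ i.2) hj (mul_left_cancel₀ h0 (h3 i)))
    let J : Fin pb.dim := ⟨j, hdim.symm ▸ hj⟩
    refine ⟨pb.basis.repr x J, ?_⟩
    have hx' : x = pb.basis.repr x J • g ^ j := by
      conv_lhs => rw [← pb.basis.sum_repr x]
      rw [Finset.sum_eq_single J (fun i _ hi ↦ ?_) (by simp), hb]
      rw [h4 i (fun h ↦ hi (Fin.ext h)), zero_smul]
    exact congr(($hx' : F)).trans (by simp [hg])

/-- If an automorphism of order dividing `p` fixes the `p`-th roots of unity (and a fourth root of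
unity when `p = 2`), then an eigenvalue `η` with `η ^ p ^ 2 = 1` is a `p`-th root of unity. -/
theorem pow_prime_eq_one_of_eigenvalue {L : Type*} [Field L] (σ : L →+* L) {p : ℕ} (hp : p.Prime)
    (hσ : ∀ x, σ^[p] x = x) (hfix : ∀ ω : L, ω ^ p = 1 → σ ω = ω)
    (hfix2 : p = 2 → ∀ ω : L, ω ^ 4 = 1 → σ ω = ω) {g η : L} (hg : g ≠ 0)
    (hgη : σ g = η * g) (hη : η ^ p ^ 2 = 1) : η ^ p = 1 := by
  have hη0 : η ≠ 0 := by rintro rfl; simp [hp.ne_zero] at hη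
  obtain ⟨ω, hω⟩ : ∃ ω, σ η = ω * η := ⟨σ η / η, by field_simp⟩
  have hωp : ω ^ p = 1 := by
    have h1 : σ (η ^ p) = η ^ p := hfix _ (by rw [← pow_mul, ← sq, hη])
    rw [map_pow, hω, mul_pow] at h1
    exact mul_right_cancel₀ (pow_ne_zero p hη0) (by rw [h1, one_mul])
  have hσω := hfix ω hωp
  have hit (n : ℕ) : σ^[n] g = ω ^ (n.choose 2) * η ^ n * g := by
    induction n with
    | zero => simp
    | succ n ih =>
      rw [Function.iterate_succ_apply', ih]
      simp only [map_mul, map_pow, hσω, hω, hgη, Nat.choose_succ_succ' n 1, Nat.choose_one_right]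
      ring
  have h := hit p
  rw [hσ] at h
  have h' : ω ^ (p.choose 2) * η ^ p = 1 := mul_right_cancel₀ hg (by rw [← h, one_mul])
  have hω1 : ω ^ (p.choose 2) = 1 := by
    rcases hp.eq_two_or_odd' with rfl | hodd
    · have := hfix2 rfl η (by simpa using hη)
      rw [hω] at this
      have : ω = 1 := mul_right_cancel₀ hη0 (by rw [this, one_mul])
      simp [this]
    · obtain ⟨m, hm⟩ : p ∣ p.choose 2 :=
        hp.dvd_choose_self two_ne_zero
          (lt_of_le_of_ne hp.two_le (by rintro rfl; exact absurd hodd (by decide)))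
      rw [hm, pow_mul, hωp, one_pow]
  rwa [hω1, one_mul] at h'

theorem pow_prime_eq_one_of_eigenvalue_of_prime_pow {L : Type*} [Field L] (σ : L →+* L) {p : ℕ}
    (hp : p.Prime)
    (hσ : ∀ x, σ^[p] x = x) (hfix : ∀ ω : L, ω ^ p = 1 → σ ω = ω)
    (hfix2 : p = 2 → ∀ ω : L, ω ^ 4 = 1 → σ ω = ω) {g η : L} (hg : g ≠ 0)
    (hgη : σ g = η * g) (m : ℕ) (hη : η ^ p ^ m = 1) : η ^ p = 1 := by
  induction m with
  | zero => simp_all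
  | succ m ih =>
    rcases m with _ | m
    · simpa using hη
    · refine ih ?_
      rw [pow_succ, pow_mul]
      exact pow_prime_eq_one_of_eigenvalue σ hp hσ hfix hfix2 (pow_ne_zero (p ^ m) hg)
        (by rw [map_pow, hgη, mul_pow]) (by rw [← pow_mul, ← pow_add, hη])

open IntermediateField in
/-- A radical of `p`-power exponent lying in the Kummer extension `K(y)` of degree `p` is a power
of `y` up to a scalar. -/
theorem exists_eq_smul_pow_of_mem_adjoin_simple {K F : Type*} [Field K] [Field F] [Algebra K F]
    {p : ℕ} (hp : p.Prime) {y : F} {a : K} (hy : y ^ p = algebraMap K F a)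
    (ha : ∀ b : K, b ^ p ≠ a) {ζ : K} (hζ : IsPrimitiveRoot ζ p) {g : F} (hg0 : g ≠ 0)
    (hg : g ∈ K⟮y⟯) {m : ℕ} (hgm : g ^ p ^ m ∈ Set.range (algebraMap K F))
    (h2 : p = 2 → (∃ i : K, IsPrimitiveRoot i 4) ∨ g ^ 2 ∈ Set.range (algebraMap K F)) :
    ∃ j < p, ∃ c : K, g = c • y ^ j := by
  obtain ⟨σ, hσ, heig⟩ := exists_kummer_algHom hp hy ha hζ
  have : NeZero p := ⟨hp.ne_zero⟩
  have hfixroot {n : ℕ} [NeZero n] {ξ : K} (hξ : IsPrimitiveRoot ξ n) (ω : K⟮y⟯)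
      (hω : ω ^ n = 1) : σ ω = ω := by
    obtain ⟨i, -, rfl⟩ :=
      (hξ.map_of_injective (algebraMap K K⟮y⟯).injective).eq_pow_of_pow_eq_one hω
    rw [map_pow, AlgHom.commutes]
  let x : K⟮y⟯ := ⟨g, hg⟩
  have hx0 : x ≠ 0 := fun h ↦ hg0 congr(($h : F))
  obtain ⟨η, hη⟩ : ∃ η, σ x = η * x := ⟨σ x / x, by field_simp⟩
  have hpow (n : ℕ) (hn : g ^ n ∈ Set.range (algebraMap K F)) : η ^ n = 1 := by
    obtain ⟨c, hc⟩ := hn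
    have hxc : x ^ n = algebraMap K _ c := Subtype.ext (by simpa [x] using hc.symm)
    have h1 : σ (x ^ n) = x ^ n := by rw [hxc, AlgHom.commutes]
    rw [map_pow, hη, mul_pow] at h1
    exact mul_right_cancel₀ (pow_ne_zero n hx0) (by rw [h1, one_mul])
  have hηp : η ^ p = 1 := by
    by_cases hcase : p = 2 ∧ g ^ 2 ∈ Set.range (algebraMap K F)
    · rw [hcase.1]; exact hpow 2 hcase.2
    · refine pow_prime_eq_one_of_eigenvalue_of_prime_pow σ.toRingHom hp hσ (hfixroot hζ)
        (fun h ↦ ?_) hx0 hη m (hpow _ hgm)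
      obtain ⟨i, hi⟩ := (h2 h).resolve_right fun h' ↦ hcase ⟨h, h'⟩
      exact hfixroot hi
  obtain ⟨j, hj, hjη⟩ :=
    (hζ.map_of_injective (algebraMap K K⟮y⟯).injective).eq_pow_of_pow_eq_one hηp
  refine ⟨j, hj, heig j hj x ?_⟩
  rw [hη, ← hjη, ← map_pow, Algebra.smul_def]

/-- The units of `F` lying in the subfield `k`. -/
def subfieldUnits {F : Type*} [Field F] (k : Subfield F) : Subgroup Fˣ where
  carrier := {u | (u : F) ∈ k}
  mul_mem' ha hb := by simpa using mul_mem ha hb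
  one_mem' := by simp
  inv_mem' {u} (hu : (u : F) ∈ k) := by simpa using inv_mem hu

theorem mem_subfieldUnits {F : Type*} [Field F] {k : Subfield F} {u : Fˣ} :
    u ∈ subfieldUnits k ↔ (u : F) ∈ k := Iff.rfl

theorem toSubfield_adjoin_eq_sup_closure {F : Type*} [Field F] (k : Subfield F) (S : Set F) :
    (IntermediateField.adjoin k S).toSubfield = k ⊔ Subfield.closure S := by
  have : (IntermediateField.adjoin k S).toSubfield =
      Subfield.closure (Set.range (algebraMap k F) ∪ S) := rfl
  rw [this, Subfield.closure_union]
  congr 1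
  conv_rhs => rw [← Subfield.closure_eq k]
  congr 1
  ext x
  exact ⟨fun ⟨a, ha⟩ ↦ ha ▸ a.2, fun hx ↦ ⟨⟨x, hx⟩, rfl⟩⟩

theorem relfinrank_sup_closure {F : Type*} [Field F] (k : Subfield F) (S : Set F) :
    k.relfinrank (k ⊔ Subfield.closure S) = Module.finrank k (IntermediateField.adjoin k S) := by
  rw [Subfield.relfinrank_eq_finrank_of_le le_sup_left]
  have : Subfield.extendScalars (le_sup_left : k ≤ k ⊔ Subfield.closure S) =
      IntermediateField.adjoin k S := by
    ext x
    rw [Subfield.mem_extendScalars, ← toSubfield_adjoin_eq_sup_closure]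
    rfl
  rw [this]

theorem pow_relIndex_mem {A : Type*} [CommGroup A] (H G : Subgroup A) {g : A} (hg : g ∈ G) :
    g ^ H.relIndex G ∈ H :=
  Subgroup.mem_subgroupOf.mp ((H.subgroupOf G).pow_index_mem ⟨g, hg⟩)

theorem exists_notMem_pow_prime_mem {A : Type*} [CommGroup A] (H G : Subgroup A) {p : ℕ}
    (hp : p.Prime) (h0 : H.relIndex G ≠ 0) (hdvd : p ∣ H.relIndex G) :
    ∃ y ∈ G, y ∉ H ∧ y ^ p ∈ H := by
  have : Fact p.Prime := ⟨hp⟩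
  have : (H.subgroupOf G).FiniteIndex := ⟨h0⟩
  obtain ⟨x, hx⟩ := exists_prime_orderOf_dvd_card' (G := G ⧸ H.subgroupOf G) p hdvd
  obtain ⟨y, rfl⟩ := QuotientGroup.mk_surjective x
  refine ⟨y, y.2, fun h ↦ hp.ne_one ?_, ?_⟩
  · rw [← hx, orderOf_eq_one_iff, QuotientGroup.eq_one_iff]
    exact h
  · have := pow_orderOf_eq_one (y : G ⧸ H.subgroupOf G)
    rw [hx, ← QuotientGroup.mk_pow, QuotientGroup.eq_one_iff] at this
    exact this

theorem relIndex_le_of_forall_eq_mul_pow {A : Type*} [CommGroup A] (H M : Subgroup A) {n : ℕ}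
    {y : A} (hy : y ∈ M) (h : ∀ g ∈ M, ∃ j < n, ∃ c ∈ H, g = c * y ^ j) : H.relIndex M ≤ n := by
  let f : Fin n → M ⧸ H.subgroupOf M := fun j ↦ ((⟨y, hy⟩ ^ (j : ℕ) : M) : M ⧸ H.subgroupOf M)
  have hf : Function.Surjective f := by
    intro x
    obtain ⟨⟨g, hg⟩, rfl⟩ := QuotientGroup.mk_surjective x
    obtain ⟨j, hj, c, hc, rfl⟩ := h g hg
    refine ⟨⟨j, hj⟩, QuotientGroup.eq.mpr ?_⟩
    rw [Subgroup.mem_subgroupOf]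
    simpa [mul_comm c] using hc
  exact (Nat.card_le_card_of_surjective f hf).trans_eq (Nat.card_fin n)

theorem relIndex_mul_relIndex_of_le {A : Type*} [Group A] {H K : Subgroup A} (hHK : H ≤ K)
    (G : Subgroup A) : H.relIndex (K ⊓ G) * K.relIndex G = H.relIndex G := by
  rw [← Subgroup.inf_relIndex_right K G, ← Subgroup.inf_relIndex_right H G,
    ← Subgroup.relIndex_mul_relIndex (H ⊓ G) (K ⊓ G) G (inf_le_inf_right G hHK) inf_le_right,
    ← Subgroup.inf_relIndex_right H (K ⊓ G), ← Subgroup.inf_relIndex_right (H ⊓ G) (K ⊓ G)]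
  congr 2
  rw [inf_assoc, inf_left_comm G, inf_idem]

/-- The `p`-primary case of Kneser's theorem over a field with enough roots of unity. -/
theorem pow_dvd_relfinrank_of_isPrimitiveRoot {F : Type*} [Field F] (G : Subgroup Fˣ) {p : ℕ}
    (hp : p.Prime) (n : ℕ) (k : Subfield F) (hζ : ∃ ζ : k, IsPrimitiveRoot ζ p)
    (h2 : p = 2 → (∃ i : k, IsPrimitiveRoot i 4) ∨ ∀ g ∈ G, (g : F) ^ 2 ∈ k)
    (hind : (subfieldUnits k).relIndex G = p ^ n) :
    p ^ n ∣ k.relfinrank (k ⊔ Subfield.closure ((↑) '' (G : Set Fˣ))) := by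
  induction n generalizing k with
  | zero => simp
  | succ n ih =>
    obtain ⟨ζ, hζ⟩ := hζ
    obtain ⟨y, hyG, hyk, hyp⟩ := exists_notMem_pow_prime_mem (subfieldUnits k) G hp
      (by rw [hind]; exact pow_ne_zero _ hp.ne_zero) (by rw [hind]; exact dvd_pow_self p (by simp))
    rw [mem_subfieldUnits] at hyk hyp
    rw [Units.val_pow_eq_pow_val] at hyp
    have : NeZero p := ⟨hp.ne_zero⟩
    have hy : (y : F) ^ p = algebraMap k F ⟨_, hyp⟩ := rfl
    have ha (b : k) : b ^ p ≠ ⟨(y : F) ^ p, hyp⟩ := by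
      intro hb
      have hb' : (b : F) ^ p = (y : F) ^ p := congr(($hb : F))
      have hb0 : (b : F) ≠ 0 := by
        intro h0
        rw [h0, zero_pow hp.ne_zero] at hb'
        exact pow_ne_zero p y.ne_zero hb'.symm
      obtain ⟨i, -, hi⟩ :=
        (hζ.map_of_injective (algebraMap k F).injective).eq_pow_of_pow_eq_one
          (ξ := (y : F) / b) (by rw [div_pow, hb', div_self (pow_ne_zero p y.ne_zero)])
      refine hyk ?_
      rw [← div_mul_cancel₀ (y : F) hb0, ← hi]
      exact mul_mem (pow_mem ζ.2 i) b.2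
    let L : Subfield F := k ⊔ Subfield.closure {(y : F)}
    have hkL : k ≤ L := le_sup_left
    have hyL : (y : F) ∈ L :=
      (le_sup_right : _ ≤ L) (Subfield.subset_closure (Set.mem_singleton _))
    have hUL : subfieldUnits k ≤ subfieldUnits L := fun u hu ↦ hkL hu
    have hL : k.relfinrank L = p := by
      rw [relfinrank_sup_closure]
      exact finrank_adjoin_simple_of_pow_prime hp hy ha
    have hle : (subfieldUnits k).relIndex (subfieldUnits L ⊓ G) ≤ p := by
      refine relIndex_le_of_forall_eq_mul_pow _ _ ⟨hyL, hyG⟩ fun g ⟨hgL, hgG⟩ ↦ ?_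
      have hgp := pow_relIndex_mem (subfieldUnits k) G hgG
      rw [hind, mem_subfieldUnits, Units.val_pow_eq_pow_val] at hgp
      have hgL' : (g : F) ∈ (IntermediateField.adjoin k {(y : F)}).toSubfield := by
        rw [toSubfield_adjoin_eq_sup_closure]
        exact hgL
      obtain ⟨j, hj, c, hc⟩ := exists_eq_smul_pow_of_mem_adjoin_simple hp hy ha hζ g.ne_zero hgL'
        (m := n + 1) ⟨⟨_, hgp⟩, rfl⟩ fun h ↦ (h2 h).imp_right fun h' ↦ ⟨⟨_, h' g hgG⟩, rfl⟩
      refine ⟨j, hj, g * (y ^ j)⁻¹, ?_, by simp⟩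
      rw [mem_subfieldUnits, Units.val_mul, hc, Subfield.smul_def]
      simp
    have hmul := relIndex_mul_relIndex_of_le hUL G
    have hr : (subfieldUnits k).relIndex (subfieldUnits L ⊓ G) = p := by
      obtain ⟨j, -, hj⟩ := (Nat.dvd_prime_pow hp).mp (hind ▸ Dvd.intro _ hmul)
      have hj0 : j ≠ 0 := by
        rintro rfl
        rw [pow_zero, Subgroup.relIndex_eq_one] at hj
        exact hyk (hj ⟨hyL, hyG⟩)
      have hj1 : j ≤ 1 := (Nat.pow_le_pow_iff_right hp.one_lt).mp (by rw [← hj, pow_one]; exact hle)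
      rw [hj, show j = 1 by omega, pow_one]
    rw [hr, hind, pow_succ'] at hmul
    have hdvd := ih L ⟨_, hζ.map_of_injective (Subfield.inclusion hkL).injective⟩
      (fun h ↦ (h2 h).imp
        (fun ⟨i, hi⟩ ↦ ⟨_, hi.map_of_injective (Subfield.inclusion hkL).injective⟩)
        fun h g hg ↦ hkL (h g hg))
      (Nat.eq_of_mul_eq_mul_left hp.pos hmul)
    have hLG : L ⊔ Subfield.closure ((↑) '' (G : Set Fˣ)) =
        k ⊔ Subfield.closure ((↑) '' (G : Set Fˣ)) := by
      have hy' : (y : F) ∈ ((↑) '' (G : Set Fˣ) : Set F) := ⟨y, hyG, rfl⟩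
      rw [sup_assoc, ← Subfield.closure_union, Set.singleton_union, Set.insert_eq_of_mem hy']
    rw [hLG] at hdvd
    rw [← Subfield.relfinrank_mul_relfinrank hkL (hLG ▸ le_sup_left), hL, pow_succ']
    exact mul_dvd_mul_left p hdvd

theorem relfinrank_sup_closure_primitiveRoot {F : Type*} [Field F] (k : Subfield F) {p : ℕ}
    (hp : p.Prime) {ζ : F} (hζ : IsPrimitiveRoot ζ p) :
    0 < k.relfinrank (k ⊔ Subfield.closure {ζ}) ∧ k.relfinrank (k ⊔ Subfield.closure {ζ}) < p := by
  have hyint : IsIntegral k ζ :=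
    isIntegral_of_pow_eq_algebraMap hp.ne_zero (hζ.pow_eq_one.trans (map_one (algebraMap k F)).symm)
  rw [relfinrank_sup_closure, IntermediateField.adjoin.finrank hyint]
  refine ⟨minpoly.natDegree_pos hyint, ?_⟩
  have hroot : Polynomial.aeval ζ (Polynomial.cyclotomic p k) = 0 := by
    rw [Polynomial.aeval_def, ← Polynomial.eval_map, Polynomial.map_cyclotomic]
    exact hζ.isRoot_cyclotomic hp.pos
  refine (Polynomial.natDegree_le_of_dvd (minpoly.dvd k ζ hroot)
    (Polynomial.cyclotomic_ne_zero p k)).trans_lt ?_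
  rw [Polynomial.natDegree_cyclotomic, Nat.totient_prime hp]
  exact Nat.sub_lt hp.pos one_pos

/-- The `p`-primary case of Kneser's theorem. -/
theorem pow_dvd_relfinrank {F : Type*} [Field F] (G : Subgroup Fˣ) {p : ℕ}
    (hp : p.Prime) (n : ℕ) (k : Subfield F) (hζ : ∃ ζ : F, IsPrimitiveRoot ζ p)
    (hroot : ∀ g ∈ G, ∀ c ∈ k, (g : F) ^ p = c ^ p → (g : F) ∈ k)
    (h2 : p = 2 → (∃ i : k, IsPrimitiveRoot i 4) ∨ ∀ g ∈ G, (g : F) ^ 2 ∈ k)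
    (hind : (subfieldUnits k).relIndex G = p ^ n) :
    p ^ n ∣ k.relfinrank (k ⊔ Subfield.closure ((↑) '' (G : Set Fˣ))) := by
  obtain ⟨ζ, hζ⟩ := hζ
  set E : Subfield F := Subfield.closure ((↑) '' (G : Set Fˣ))
  set Z : Subfield F := Subfield.closure {ζ}
  have hkL : k ≤ k ⊔ Z := le_sup_left
  have hζL : ζ ∈ k ⊔ Z := (le_sup_right : Z ≤ _) (Subfield.subset_closure (Set.mem_singleton _))
  obtain ⟨hpos, hlt⟩ := relfinrank_sup_closure_primitiveRoot k hp hζ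
  have hmem (m : ℕ) : ∀ g ∈ G, (g : F) ^ p ^ m ∈ k → (g : F) ∈ k ⊔ Z → (g : F) ∈ k := by
    induction m with
    | zero => intro g _ h _; simpa using h
    | succ m ih =>
      intro g hg hgm hgL
      refine ih g hg ?_ hgL
      by_contra hgk
      have hgp : ((g : F) ^ p ^ m) ^ p ∈ k := by rwa [← pow_mul, ← pow_succ]
      have ha (b : k) : b ^ p ≠ ⟨_, hgp⟩ := fun hb ↦ hgk <| by
        have := hroot (g ^ p ^ m) (pow_mem hg _) b b.2
          (by simpa using congr(($hb : F)).symm)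
        simpa using this
      have hfin := finrank_adjoin_simple_of_pow_prime (K := k) hp (y := (g : F) ^ p ^ m)
        (a := ⟨_, hgp⟩) rfl ha
      rw [← relfinrank_sup_closure] at hfin
      have hle : k ⊔ Subfield.closure {(g : F) ^ p ^ m} ≤ k ⊔ Z :=
        sup_le le_sup_left (Subfield.closure_le.mpr (by simpa using pow_mem hgL _))
      have := Nat.le_of_dvd hpos
        (Dvd.intro _ (Subfield.relfinrank_mul_relfinrank le_sup_left hle))
      omega
  have hind' : (subfieldUnits (k ⊔ Z)).relIndex G = p ^ n := by
    rw [← hind, ← Subgroup.inf_relIndex_right (subfieldUnits (k ⊔ Z)),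
      ← Subgroup.inf_relIndex_right (subfieldUnits k)]
    congr 1
    refine le_antisymm (fun g ⟨hgL, hg⟩ ↦ ⟨hmem n g hg ?_ hgL, hg⟩)
      (inf_le_inf_right G fun u hu ↦ hkL hu)
    have := pow_relIndex_mem (subfieldUnits k) G hg
    rwa [hind, mem_subfieldUnits, Units.val_pow_eq_pow_val] at this
  have hdvd := pow_dvd_relfinrank_of_isPrimitiveRoot G hp n (k ⊔ Z)
    ⟨⟨ζ, hζL⟩, IsPrimitiveRoot.coe_submonoidClass_iff.mp hζ⟩
    (fun h ↦ (h2 h).imp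
      (fun ⟨i, hi⟩ ↦ ⟨_, hi.map_of_injective (Subfield.inclusion hkL).injective⟩)
      fun h g hg ↦ hkL (h g hg)) hind'
  obtain ⟨hpos', hlt'⟩ := relfinrank_sup_closure_primitiveRoot (k ⊔ E) hp hζ
  have hcop : (p ^ n).Coprime ((k ⊔ E).relfinrank (k ⊔ E ⊔ Z)) :=
    Nat.Coprime.pow_left n (Nat.coprime_of_lt_prime hpos'.ne' hlt' hp)
  refine hcop.dvd_of_dvd_mul_right ?_
  rw [Subfield.relfinrank_mul_relfinrank le_sup_left le_sup_left, sup_right_comm,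
    ← Subfield.relfinrank_mul_relfinrank hkL le_sup_left]
  exact hdvd.mul_left _

theorem exists_relIndex_eq_prime_pow {A : Type*} [CommGroup A] (H G : Subgroup A) {p n : ℕ}
    (hp : p.Prime) (h0 : H.relIndex G ≠ 0) (hdvd : p ^ n ∣ H.relIndex G) :
    ∃ P ≤ G, H.relIndex P = p ^ n := by
  have : Fact p.Prime := ⟨hp⟩
  have : (H.subgroupOf G).FiniteIndex := ⟨h0⟩
  obtain ⟨S, hS⟩ := Sylow.exists_subgroup_card_pow_prime (G := G ⧸ H.subgroupOf G) p hdvd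
  refine ⟨(S.comap (QuotientGroup.mk' _)).map G.subtype, Subgroup.map_subtype_le _, ?_⟩
  rw [← Subgroup.relIndex_comap, ← hS, ← Subgroup.relIndex_bot_left S]
  conv_rhs => rw [← Subgroup.map_comap_eq_self_of_surjective
    (QuotientGroup.mk'_surjective (H.subgroupOf G)) S]
  rw [← Subgroup.relIndex_comap, MonoidHom.comap_bot, QuotientGroup.ker_mk']
  rfl

/-- Kneser's theorem for finite index, in divisibility form. -/
theorem relIndex_dvd_relfinrank {F : Type*} [Field F] [IsAlgClosed F] (k : Subfield F)
    (G : Subgroup Fˣ) (h0 : (subfieldUnits k).relIndex G ≠ 0)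
    (hroot : ∀ p : ℕ, p.Prime → (∃ y ∈ G, (y : F) ∉ k ∧ (y : F) ^ p ∈ k) →
      (p : F) ≠ 0 ∧ ∀ g ∈ G, ∀ c ∈ k, (g : F) ^ p = c ^ p → (g : F) ∈ k)
    (h4 : (∃ i : k, IsPrimitiveRoot i 4) ∨ ∀ g ∈ G, (g : F) ^ 4 ∈ k → (g : F) ^ 2 ∈ k) :
    (subfieldUnits k).relIndex G ∣ k.relfinrank (k ⊔ Subfield.closure ((↑) '' (G : Set Fˣ))) := by
  rw [Nat.dvd_iff_prime_pow_dvd_dvd]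
  intro p n hp hdvd
  rcases n.eq_zero_or_pos with rfl | hn
  · simp
  obtain ⟨P, hPG, hP⟩ := exists_relIndex_eq_prime_pow _ G hp h0 hdvd
  obtain ⟨y, hyG, hyk, hyp⟩ := exists_notMem_pow_prime_mem (subfieldUnits k) G hp h0
    ((dvd_pow_self p hn.ne').trans hdvd)
  obtain ⟨hpF, hrootp⟩ := hroot p hp ⟨y, hyG, hyk, by simpa [mem_subfieldUnits] using hyp⟩
  have : NeZero (p : F) := ⟨hpF⟩
  have hle : k ⊔ Subfield.closure ((↑) '' (P : Set Fˣ)) ≤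
      k ⊔ Subfield.closure ((↑) '' (G : Set Fˣ)) :=
    sup_le_sup_left (Subfield.closure_mono (Set.image_mono hPG)) k
  rw [← Subfield.relfinrank_mul_relfinrank le_sup_left hle]
  refine (pow_dvd_relfinrank P hp n k (HasEnoughRootsOfUnity.exists_primitiveRoot F p)
    (fun g hg ↦ hrootp g (hPG hg)) (fun hp2 ↦ h4.imp_right fun h g hg ↦ ?_) hP).mul_right _
  have hdown (m : ℕ) : (g : F) ^ 2 ^ (m + 1) ∈ k → (g : F) ^ 2 ∈ k := by
    induction m with
    | zero => simp
    | succ m ih =>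
      refine fun hm ↦ ih ?_
      have := h (g ^ 2 ^ m) (pow_mem (hPG hg) _)
      rw [Units.val_pow_eq_pow_val, ← pow_mul, ← pow_mul, ← pow_succ,
        show 2 ^ m * 4 = 2 ^ (m + 1 + 1) by ring] at this
      exact this hm
  have := pow_relIndex_mem (subfieldUnits k) P hg
  rw [hP, hp2, mem_subfieldUnits, Units.val_pow_eq_pow_val, ← Nat.sub_add_cancel hn] at this
  exact hdown _ this

/-- A group of radicals spans the field it generates. -/
theorem toSubmodule_adjoin_eq_span {K F : Type*} [Field K] [Field F] [Algebra K F]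
    (G : Subgroup Fˣ) (htors : ∀ g ∈ G, ∃ n ≠ 0, (g : F) ^ n ∈ Set.range (algebraMap K F)) :
    Subalgebra.toSubmodule (IntermediateField.adjoin K ((↑) '' (G : Set Fˣ))).toSubalgebra =
      Submodule.span K ((↑) '' (G : Set Fˣ) : Set F) := by
  rw [IntermediateField.adjoin_toSubalgebra_of_isAlgebraic, Algebra.adjoin_eq_span]
  · congr 1
    exact congrArg SetLike.coe (Submonoid.closure_eq (G.toSubmonoid.map (Units.coeHom F)))
  · rintro _ ⟨g, hg, rfl⟩
    obtain ⟨n, hn, a, ha⟩ := htors g hg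
    exact (isIntegral_of_pow_eq_algebraMap hn ha.symm).isAlgebraic

theorem span_range_eq_span_of_forall_exists_smul {K V ι : Type*} [Semiring K] [AddCommMonoid V]
    [Module K V] {v : ι → V} {S : Set V} (hv : ∀ i, v i ∈ S)
    (hS : ∀ x ∈ S, ∃ i, ∃ c : K, x = c • v i) :
    Submodule.span K (Set.range v) = Submodule.span K S := by
  refine le_antisymm (Submodule.span_mono (Set.range_subset_iff.mpr hv))
    (Submodule.span_le.mpr fun x hx ↦ ?_)
  obtain ⟨i, c, rfl⟩ := hS x hx
  exact Submodule.smul_mem _ c (Submodule.subset_span ⟨i, rfl⟩)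

theorem linearIndependent_of_card_dvd_finrank {K F ι : Type*} [Field K] [Field F] [Algebra K F]
    [Fintype ι] {v : ι → F} {E : IntermediateField K F}
    (hspan : Submodule.span K (Set.range v) = Subalgebra.toSubmodule E.toSubalgebra)
    (hdvd : Fintype.card ι ∣ Module.finrank K E) : LinearIndependent K v := by
  rw [linearIndependent_iff_card_eq_finrank_span]
  refine le_antisymm ?_ (finrank_range_le_card _)
  have hfin : FiniteDimensional K (Subalgebra.toSubmodule E.toSubalgebra) := by
    rw [← hspan]
    exact FiniteDimensional.span_of_finite K (Set.finite_range _)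
  have : FiniteDimensional K E := hfin
  rw [Set.finrank, hspan]
  exact Nat.le_of_dvd (Module.finrank_pos (R := K) (M := E)) hdvd

/-- Coset representatives of `k*` in a finite extension of it are linearly independent. -/
theorem linearIndependent_quotient_out {F : Type*} [Field F] [IsAlgClosed F] (k : Subfield F)
    (G : Subgroup Fˣ) (h0 : (subfieldUnits k).relIndex G ≠ 0)
    (hroot : ∀ p : ℕ, p.Prime → (∃ y ∈ G, (y : F) ∉ k ∧ (y : F) ^ p ∈ k) →
      (p : F) ≠ 0 ∧ ∀ g ∈ G, ∀ c ∈ k, (g : F) ^ p = c ^ p → (g : F) ∈ k)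
    (h4 : (∃ i : k, IsPrimitiveRoot i 4) ∨ ∀ g ∈ G, (g : F) ^ 4 ∈ k → (g : F) ^ 2 ∈ k) :
    LinearIndependent k
      (fun q : G ⧸ (subfieldUnits k).subgroupOf G ↦ ((q.out : Fˣ) : F)) := by
  have : ((subfieldUnits k).subgroupOf G).FiniteIndex := ⟨h0⟩
  have := Fintype.ofFinite (G ⧸ (subfieldUnits k).subgroupOf G)
  have hspan := span_range_eq_span_of_forall_exists_smul (K := k)
    (v := fun q : G ⧸ (subfieldUnits k).subgroupOf G ↦ ((q.out : Fˣ) : F))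
    (S := (↑) '' (G : Set Fˣ)) (fun q ↦ ⟨_, q.out.2, rfl⟩) (by
      rintro _ ⟨g, hg, rfl⟩
      have h := QuotientGroup.eq.mp (QuotientGroup.out_eq'
        ((⟨g, hg⟩ : G) : G ⧸ (subfieldUnits k).subgroupOf G))
      rw [Subgroup.mem_subgroupOf, mem_subfieldUnits] at h
      refine ⟨((⟨g, hg⟩ : G) : G ⧸ (subfieldUnits k).subgroupOf G), ⟨_, h⟩, ?_⟩
      rw [Subfield.smul_def, smul_eq_mul, ← Units.val_mul]
      simp [mul_comm])
  rw [← toSubmodule_adjoin_eq_span G fun g hg ↦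
    ⟨_, h0, ⟨_, pow_relIndex_mem (subfieldUnits k) G hg⟩, Units.val_pow_eq_pow_val _ _⟩] at hspan
  refine linearIndependent_of_card_dvd_finrank hspan ?_
  have hdvd := relIndex_dvd_relfinrank k G h0 hroot h4
  rw [relfinrank_sup_closure] at hdvd
  exact Nat.card_eq_fintype_card (α := G ⧸ (subfieldUnits k).subgroupOf G) ▸ hdvd

theorem linearIndependent_of_inequivalent {F ι : Type*} [Field F] [IsAlgClosed F] (k : Subfield F)
    (G : Subgroup Fˣ) (htors : ∀ g ∈ G, ∃ n ≠ 0, g ^ n ∈ subfieldUnits k)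
    (hroot : ∀ p : ℕ, p.Prime → (∃ y ∈ G, (y : F) ∉ k ∧ (y : F) ^ p ∈ k) →
      (p : F) ≠ 0 ∧ ∀ g ∈ G, ∀ c ∈ k, (g : F) ^ p = c ^ p → (g : F) ∈ k)
    (h4 : (∃ i : k, IsPrimitiveRoot i 4) ∨ ∀ g ∈ G, (g : F) ^ 4 ∈ k → (g : F) ^ 2 ∈ k)
    {t : ι → Fˣ} (ht : ∀ i, t i ∈ G) (hinj : ∀ i j, (t i)⁻¹ * t j ∈ subfieldUnits k → i = j) :
    LinearIndependent k (fun i ↦ (t i : F)) := by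
  rw [linearIndependent_iff_finset_linearIndependent]
  intro s
  let H : Subgroup Fˣ := Subgroup.closure (t '' s)
  have hHG : H ≤ G := (Subgroup.closure_le G).mpr (by rintro _ ⟨i, -, rfl⟩; exact ht i)
  have htH (i : s) : t i ∈ H := Subgroup.subset_closure ⟨i, i.2, rfl⟩
  let Q := H ⧸ (subfieldUnits k).subgroupOf H
  have hfg : Group.FG H := Group.closure_finite_fg _
  have hQ : IsMulTorsion Q := by
    intro x
    obtain ⟨⟨g, hg⟩, rfl⟩ := QuotientGroup.mk_surjective x
    obtain ⟨n, hn, hgn⟩ := htors g (hHG hg)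
    refine isOfFinOrder_iff_pow_eq_one.mpr ⟨n, Nat.pos_of_ne_zero hn, ?_⟩
    rw [← QuotientGroup.mk_pow, QuotientGroup.eq_one_iff]
    exact hgn
  have : Finite Q := CommGroup.finite_of_fg_isMulTorsion Q hQ
  have h0 : (subfieldUnits k).relIndex H ≠ 0 := Nat.card_pos.ne'
  have hli := linearIndependent_quotient_out k H h0
    (fun p hp ⟨y, hy, h⟩ ↦ (hroot p hp ⟨y, hHG hy, h⟩).imp_right fun h g hg ↦ h g (hHG hg))
    (h4.imp_right fun h g hg ↦ h g (hHG hg))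
  let q : s → Q := fun i ↦ ((⟨t i, htH i⟩ : H) : Q)
  have hq : Function.Injective q := fun i j hij ↦
    Subtype.ext (hinj _ _ (Subgroup.mem_subgroupOf.mp (QuotientGroup.eq.mp hij)))
  have hmem (i : s) : (((q i).out : Fˣ) : F)⁻¹ * t i ∈ k := by
    have h := QuotientGroup.eq.mp (QuotientGroup.out_eq' (q i))
    rw [Subgroup.mem_subgroupOf, mem_subfieldUnits] at h
    simpa using h
  convert (hli.comp q hq).units_smul fun i ↦ Units.mk0 ⟨_, hmem i⟩ fun h ↦ by
    simpa using congr(($h : F)) using 1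
  ext i
  simp [Units.smul_def, Subfield.smul_def, mul_comm]

theorem mem_fieldUnitsRange_iff {K F : Type*} [Field K] [Field F] [Algebra K F] {u : Fˣ} :
    u ∈ fieldUnitsRange K F ↔ (u : F) ∈ Set.range (algebraMap K F) := by
  constructor
  · rintro ⟨c, rfl⟩
    exact ⟨c, rfl⟩
  · rintro ⟨c, hc⟩
    have hc0 : c ≠ 0 := by
      rintro rfl
      exact u.ne_zero (by rw [← hc, map_zero])
    exact ⟨Units.mk0 c hc0, Units.ext hc⟩

/-- Kneser's theorem: inequivalent radicals are linearly independent. -/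
theorem linearIndependent_of_radicals {K F ι : Type*} [Field K] [Field F] [Algebra K F]
    (G : Subgroup Fˣ) (htors : ∀ g ∈ G, ∃ n ≠ 0, g ^ n ∈ fieldUnitsRange K F)
    (hroot : ∀ p : ℕ, p.Prime → (∃ y ∈ G, y ∉ fieldUnitsRange K F ∧ y ^ p ∈ fieldUnitsRange K F) →
      (p : K) ≠ 0 ∧ ∀ g ∈ G, ∀ c : K, (g : F) ^ p = algebraMap K F c ^ p →
        g ∈ fieldUnitsRange K F)
    (h4 : (∃ i : K, IsPrimitiveRoot i 4) ∨
      ∀ g ∈ G, g ^ 4 ∈ fieldUnitsRange K F → g ^ 2 ∈ fieldUnitsRange K F)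
    {t : ι → Fˣ} (ht : ∀ i, t i ∈ G) (hinj : ∀ i j, (t i)⁻¹ * t j ∈ fieldUnitsRange K F → i = j) :
    LinearIndependent K (fun i ↦ (t i : F)) := by
  let Ω := AlgebraicClosure F
  let k : Subfield Ω := (algebraMap K Ω).fieldRange
  let φ : Fˣ →* Ωˣ := Units.map (algebraMap F Ω : F →* Ω)
  have hφ (u : Fˣ) : (φ u : Ω) = algebraMap F Ω u := rfl
  have hinjF : Function.Injective (algebraMap F Ω) := (algebraMap F Ω).injective
  have hk (x : F) : algebraMap F Ω x ∈ k ↔ x ∈ Set.range (algebraMap K F) := by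
    constructor
    · rintro ⟨c, hc⟩
      exact ⟨c, hinjF (by rw [← hc, ← IsScalarTower.algebraMap_apply])⟩
    · rintro ⟨c, rfl⟩
      exact ⟨c, IsScalarTower.algebraMap_apply K F Ω c⟩
  have hmem (u : Fˣ) : φ u ∈ subfieldUnits k ↔ u ∈ fieldUnitsRange K F := by
    rw [mem_subfieldUnits, hφ, hk, mem_fieldUnitsRange_iff]
  have hmem' (u : Fˣ) (n : ℕ) : (φ u : Ω) ^ n ∈ k ↔ u ^ n ∈ fieldUnitsRange K F := by
    rw [← hmem, map_pow, mem_subfieldUnits, Units.val_pow_eq_pow_val]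
  have hli : LinearIndependent k (fun i ↦ (φ (t i) : Ω)) := by
    refine linearIndependent_of_inequivalent k (G.map φ) ?_ ?_ ?_
      (fun i ↦ Subgroup.mem_map_of_mem φ (ht i)) (fun i j h ↦ hinj i j ?_)
    · rintro _ ⟨g, hg, rfl⟩
      obtain ⟨n, hn, h⟩ := htors g hg
      exact ⟨n, hn, by rwa [← map_pow, hmem]⟩
    · rintro p hp ⟨_, ⟨y, hy, rfl⟩, hyk, hyp⟩
      obtain ⟨hpK, hr⟩ := hroot p hp ⟨y, hy, fun h ↦ hyk ((hmem y).mpr h), (hmem' y p).mp hyp⟩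
      refine ⟨by simpa using (algebraMap K Ω).injective.ne hpK, ?_⟩
      rintro _ ⟨g, hg, rfl⟩ _ ⟨c, rfl⟩ h
      refine (hmem g).mpr (hr g hg c (hinjF ?_))
      rwa [map_pow, map_pow, ← IsScalarTower.algebraMap_apply]
    · refine h4.imp (fun ⟨i, hi⟩ ↦
        ⟨_, hi.map_of_injective (algebraMap K Ω).rangeRestrictField.injective⟩) ?_
      rintro h _ ⟨g, hg, rfl⟩
      rw [hmem', hmem']
      exact h g hg
    · rwa [← map_inv, ← map_mul, hmem] at h
  rw [linearIndependent_iff'] at hli ⊢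
  intro s c hc i hi
  have h := hli s (fun i ↦ (algebraMap K Ω).rangeRestrictField (c i)) ?_ i hi
  · exact (map_eq_zero _).mp h
  · have := congr(algebraMap F Ω $hc)
    simp only [Algebra.smul_def, map_sum, map_mul, map_zero,
      ← IsScalarTower.algebraMap_apply] at this
    exact this


/-- Theorem 1.3: `k(G) = ⊕_{t ∈ T} k·t` for any transversal `T` of `k*` in `G`. -/
theorem adjoin_eq_directSum_over_transversal
    (K F : Type*) [Field K] [Field F] [Algebra K F] (G : Subgroup Fˣ)
    (hKG : fieldUnitsRange K F ≤ G)
    -- the quotient group G/k* is torsion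
    (htors : ∀ x : G ⧸ (fieldUnitsRange K F).subgroupOf G, IsOfFinOrder x)
    -- k contains a primitive 4th root of unity whenever G/k* has an element of order 4
    (h4 : (∃ x : G ⧸ (fieldUnitsRange K F).subgroupOf G, orderOf x = 4) →
      ∃ ζ : K, IsPrimitiveRoot ζ 4)
    -- for every prime p in π(t(G)) ∩ π(G/k*), k contains a primitive p-th root of unity
    (hp : ∀ p : ℕ, p.Prime → (∃ g : G, IsOfFinOrder g ∧ p ∣ orderOf g) →
      (∃ x : G ⧸ (fieldUnitsRange K F).subgroupOf G, p ∣ orderOf x ∧ x ≠ 1) →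
      ∃ ζ : K, IsPrimitiveRoot ζ p)
    -- the characteristic of k does not belong to π(G/k*)
    (hchar : ∀ p : ℕ, p.Prime →
      (∃ x : G ⧸ (fieldUnitsRange K F).subgroupOf G, p ∣ orderOf x ∧ x ≠ 1) →
      ringChar K ≠ p)
    -- T is a transversal to the subgroup k* in G
    (T : Set Fˣ) (hTG : T ⊆ (G : Set Fˣ))
    (htrans : ∀ g ∈ G, ∃! t, t ∈ T ∧ t⁻¹ * g ∈ fieldUnitsRange K F) :
    iSupIndep (fun t : T => (Submodule.span K {((t : Fˣ) : F)} : Submodule K F)) ∧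
      (⨆ t : T, (Submodule.span K {((t : Fˣ) : F)} : Submodule K F)) =
        Subalgebra.toSubmodule
          (IntermediateField.adjoin K ((fun u : Fˣ => (u : F)) '' (G : Set Fˣ))).toSubalgebra := by
  have hQ {g : Fˣ} (hg : g ∈ G) (n : ℕ) :
      ((⟨g, hg⟩ : G) : G ⧸ (fieldUnitsRange K F).subgroupOf G) ^ n = 1 ↔
        g ^ n ∈ fieldUnitsRange K F := by
    rw [← QuotientGroup.mk_pow, QuotientGroup.eq_one_iff]
    rfl
  have htors' : ∀ g ∈ G, ∃ n ≠ 0, g ^ n ∈ fieldUnitsRange K F := fun g hg ↦ by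
    obtain ⟨n, hn, h⟩ := isOfFinOrder_iff_pow_eq_one.mp (htors (⟨g, hg⟩ : G))
    exact ⟨n, hn.ne', (hQ hg n).mp h⟩
  constructor
  · refine LinearIndependent.iSupIndep_span_singleton (linearIndependent_of_radicals G htors'
      (fun p hp_prime ⟨y, hy, hyK, hyp⟩ ↦ ?_) ?_ (t := ((↑) : T → Fˣ)) (fun t ↦ hTG t.2)
      (fun s t hst ↦ ?_))
    · have : Fact p.Prime := ⟨hp_prime⟩
      have hy1 : ((⟨y, hy⟩ : G) : G ⧸ (fieldUnitsRange K F).subgroupOf G) ≠ 1 := fun h ↦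
        hyK (by simpa using (hQ hy 1).mp (by rw [pow_one, h]))
      have hx : ∃ x : G ⧸ (fieldUnitsRange K F).subgroupOf G, p ∣ orderOf x ∧ x ≠ 1 :=
        ⟨_, (orderOf_eq_prime ((hQ hy p).mpr hyp) hy1).symm.dvd, hy1⟩
      refine ⟨fun h0 ↦ ?_, fun g hg c hgc ↦ ?_⟩
      · rcases (Nat.dvd_prime hp_prime).mp (ringChar.dvd h0) with h | h
        · exact CharP.ringChar_ne_one h
        · exact hchar p hp_prime hx h
      · have hc0 : algebraMap K F c ≠ 0 := by
          intro h
          rw [h, zero_pow hp_prime.ne_zero] at hgc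
          exact pow_ne_zero p g.ne_zero hgc
        let u : Fˣ := Units.mk0 _ hc0
        have hu : u ∈ fieldUnitsRange K F := mem_fieldUnitsRange_iff.mpr ⟨c, rfl⟩
        have hgu : g / u ∈ G := div_mem hg (hKG hu)
        have hgup : (g / u) ^ p = 1 := by
          rw [div_pow, div_eq_one]
          exact Units.ext (by simpa [u] using hgc)
        suffices g / u ∈ fieldUnitsRange K F by simpa using mul_mem this hu
        by_cases h1 : g / u = 1
        · rw [h1]; exact one_mem _
        have hord : orderOf (⟨g / u, hgu⟩ : G) = p :=
          orderOf_eq_prime (Subtype.ext hgup) fun h ↦ h1 congr(($h : Fˣ))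
        obtain ⟨ζ, hζ⟩ := hp p hp_prime
          ⟨⟨g / u, hgu⟩, orderOf_pos_iff.mp (hord ▸ hp_prime.pos), hord.symm.dvd⟩ hx
        have : NeZero p := ⟨hp_prime.ne_zero⟩
        obtain ⟨i, -, hi⟩ :=
          (hζ.map_of_injective (algebraMap K F).injective).eq_pow_of_pow_eq_one
            (ξ := ((g / u : Fˣ) : F)) (by rw [← Units.val_pow_eq_pow_val, hgup, Units.val_one])
        exact mem_fieldUnitsRange_iff.mpr ⟨ζ ^ i, by rw [map_pow, hi]⟩
    · by_cases hx : ∃ x : G ⧸ (fieldUnitsRange K F).subgroupOf G, orderOf x = 4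
      · exact Or.inl (h4 hx)
      · refine Or.inr fun g hg hg4 ↦ ?_
        by_contra hg2
        exact hx ⟨_, orderOf_eq_prime_pow (p := 2) (n := 1) (fun h ↦ hg2 ((hQ hg 2).mp h))
          ((hQ hg 4).mpr hg4)⟩
    · exact Subtype.ext ((htrans t (hTG t.2)).unique ⟨s.2, hst⟩ ⟨t.2, by simp⟩)
  · rw [toSubmodule_adjoin_eq_span G fun g hg ↦ ?_, ← Submodule.span_range_eq_iSup]
    · refine span_range_eq_span_of_forall_exists_smul (fun t ↦ ⟨t, hTG t.2, rfl⟩) ?_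
      rintro _ ⟨g, hg, rfl⟩
      obtain ⟨t, ⟨htT, htg⟩, -⟩ := htrans g hg
      obtain ⟨c, hc⟩ := mem_fieldUnitsRange_iff.mp htg
      refine ⟨⟨t, htT⟩, c, ?_⟩
      rw [Algebra.smul_def, hc, ← Units.val_mul]
      simp [mul_comm]
    · obtain ⟨n, hn, h⟩ := htors' g hg
      exact ⟨n, hn, by simpa using mem_fieldUnitsRange_iff.mp h⟩
end

section
/- Let k be a subfield of a field f and let G be a subgroup of the multiplicative group f* (not necessarily containing k*). Assume that the quotient group Gk*/k* is torsion; that k contains a primitive 4th root of unity whenever Gk*/k* has an element of order 4; that for every prime p lying both in π(t(Gk*)) and in π(Gk*/k*) the field k contains a primitive p-th root of unity; and that the characteristic of k does not belong to π(Gk*/k*). Then k(G) = ⊕_{t ∈ T} k(k* ∩ G)·t, where T is any transversal to the subgroup k* ∩ G in G. -/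
universe u

open Polynomial in
theorem Irreducible.minpoly_eq_X_pow_sub_C {K E : Type*} [Field K] [Field E] [Algebra K E] {n : ℕ}
    (hn : n ≠ 0) {c : K} (hc : Irreducible (X ^ n - C c)) {α : E} (hα : α ^ n = algebraMap K E c) :
    minpoly K α = X ^ n - C c :=
  (minpoly.eq_of_irreducible_of_monic hc (by simp [hα]) (monic_X_pow_sub_C c hn)).symm

theorem Set.exists_prime_pow_mem {M : Type*} [Monoid M] (A : Set M) {n : ℕ} (hn : n ≠ 0)
    {x : M} (hx : x ∉ A) (hxn : x ^ n ∈ A) :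
    ∃ m q : ℕ, q.Prime ∧ q ∣ n ∧ x ^ m ∉ A ∧ (x ^ m) ^ q ∈ A := by
  induction n using induction_on_primes with
  | zero => exact absurd rfl hn
  | one => exact absurd (by simpa using hxn) hx
  | prime_mul p a hp ih =>
    by_cases h : x ^ a ∈ A
    · obtain ⟨m, q, hq, hqa, h1, h2⟩ := ih (by rintro rfl; simp at hn) h
      exact ⟨m, q, hq, hqa.mul_left p, h1, h2⟩
    · exact ⟨a, p, hp, dvd_mul_right _ _, h, by rwa [← pow_mul, mul_comm a p]⟩

/-- If the base field has a primitive `p`-th root of unity, it contains all `p`-th roots of unity of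
an extension. -/
theorem IsPrimitiveRoot.mem_range_algebraMap_of_pow_eq_one {K E : Type*} [Field K] [Field E]
    [Algebra K E] {ζ : K} {p : ℕ} (hp : p ≠ 0) (hζ : IsPrimitiveRoot ζ p) {x : E} (hx : x ^ p = 1) :
    ∃ j < p, x = algebraMap K E (ζ ^ j) := by
  have : NeZero p := ⟨hp⟩
  obtain ⟨j, hj, h⟩ := (hζ.map_of_injective (algebraMap K E).injective).eq_pow_of_pow_eq_one hx
  exact ⟨j, hj, by rw [← h, map_pow]⟩

open Polynomial in
theorem irreducible_X_pow_sub_C_of_notMem_range {K E : Type*} [Field K] [Field E] [Algebra K E]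
    {p : ℕ} (hp : p.Prime) {α : E} {c : K}
    (hroot : ∀ b : K, b ≠ 0 → (α / algebraMap K E b) ^ p = 1 →
      α / algebraMap K E b ∈ (algebraMap K E).range)
    (hα : α ∉ (algebraMap K E).range) (hc : α ^ p = algebraMap K E c) :
    Irreducible (X ^ p - C c) := by
  refine X_pow_sub_C_irreducible_of_prime hp fun b hb => hα ?_
  have hα0 : α ≠ 0 := fun h => hα (h ▸ zero_mem _)
  have hb0 : b ≠ 0 := by
    rintro rfl
    rw [← hb, zero_pow hp.ne_zero, map_zero] at hc
    exact hα0 (pow_eq_zero_iff hp.ne_zero |>.1 hc)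
  have hb0' : algebraMap K E b ≠ 0 := by simpa using hb0
  obtain ⟨z, hz⟩ := hroot b hb0 (by rw [div_pow, hc, ← hb, map_pow, div_self (pow_ne_zero _ hb0')])
  exact ⟨z * b, by rw [map_mul, hz, div_mul_cancel₀ _ hb0']⟩

open IntermediateField Polynomial in
theorem exists_aut_of_adjoin_root_eq_top {K E : Type*} [Field K] [Field E] [Algebra K E]
    {p : ℕ} (hp : p.Prime) {ζ : K} (hζ : IsPrimitiveRoot ζ p)
    {α : E} (hα : α ∉ (algebraMap K E).range) {c : K} (hc : α ^ p = algebraMap K E c)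
    (htop : K⟮α⟯ = ⊤) :
    ∃ σ : Gal(E/K), σ ^ p = 1 ∧ ∀ x, σ x = x → x ∈ (algebraMap K E).range := by
  have hirr := irreducible_X_pow_sub_C_of_notMem_range hp
    (fun b _ h => let ⟨j, _, h⟩ := hζ.mem_range_algebraMap_of_pow_eq_one hp.ne_zero h
      ⟨ζ ^ j, h.symm⟩) hα hc
  have hmin := hirr.minpoly_eq_X_pow_sub_C hp.ne_zero hc
  have hint : IsIntegral K α := ⟨X ^ p - C c, monic_X_pow_sub_C c hp.ne_zero, by simp [hc]⟩
  have hrank : Module.finrank K E = p := by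
    rw [← finrank_top', ← htop, adjoin.finrank hint, hmin, natDegree_X_pow_sub_C]
  have : FiniteDimensional K E := Module.finite_of_finrank_pos (hrank ▸ hp.pos)
  have hne : (primitiveRoots (Module.finrank K E) K).Nonempty :=
    ⟨ζ, (mem_primitiveRoots (hrank ▸ hp.pos)).2 (hrank ▸ hζ)⟩
  have hspl := isSplittingField_X_pow_sub_C_of_root_adjoin_eq_top hne (hrank.symm ▸ hc) htop
  have hgal : IsGalois K E := isGalois_of_isSplittingField_X_pow_sub_C hne (hrank.symm ▸ hirr) E
  have hcard : Nat.card Gal(E/K) = p := by rw [IsGalois.card_aut_eq_finrank, hrank]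
  have : Fact p.Prime := ⟨hp⟩
  have : Nontrivial Gal(E/K) := Finite.one_lt_card_iff_nontrivial.1 (hcard ▸ hp.one_lt)
  obtain ⟨σ, hσ⟩ := exists_ne (1 : Gal(E/K))
  refine ⟨σ, by rw [← hcard, pow_card_eq_one'], fun x hx => ?_⟩
  refine (IsGalois.mem_range_algebraMap_iff_fixed x).2 fun τ => ?_
  obtain ⟨j, rfl⟩ : τ ∈ Submonoid.powers σ := mem_powers_of_prime_card hcard hσ
  induction j with
  | zero => rfl
  | succ j ih => simpa [pow_succ, hx] using ih

/-- Iterating a `K`-automorphism on an element it multiplies by `ω`, when it multiplies `ω`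
by the scalar `η`. -/
theorem AlgEquiv.iterate_apply_of_apply_eq_mul {K E : Type*} [Field K] [Field E] [Algebra K E]
    (σ : Gal(E/K)) {g ω : E} {η : K} (hg : σ g = ω * g) (hω : σ ω = algebraMap K E η * ω) (i : ℕ) :
    (σ ^ i) g = algebraMap K E η ^ (i.choose 2) * ω ^ i * g := by
  induction i with
  | zero => simp
  | succ i ih =>
    rw [pow_succ', AlgEquiv.mul_apply, ih, Nat.choose_succ_succ' i 1, Nat.choose_one_right]
    simp only [map_mul, map_pow, hg, hω, AlgEquiv.commutes]
    ring

open IntermediateField in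
/-- In a Kummer extension `K(α)` of prime degree, an element with a power in `K` is a scalar times a
power of `α`, given enough roots of unity in `K`. -/
theorem exists_eq_mul_pow_of_pow_mem_range {K E : Type*} [Field K] [Field E] [Algebra K E]
    {p : ℕ} (hp : p.Prime) {ζ : K} (hζ : IsPrimitiveRoot ζ p)
    {α : E} (hα : α ∉ (algebraMap K E).range) (hαp : α ^ p ∈ (algebraMap K E).range)
    (htop : K⟮α⟯ = ⊤) {n : ℕ} (hn : n ≠ 0)
    (hroots : ∀ q : ℕ, q.Prime → q ∣ n → ∃ ζ : K, IsPrimitiveRoot ζ q)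
    (h4 : 4 ∣ n → ∃ ζ : K, IsPrimitiveRoot ζ 4)
    {g : E} (hg0 : g ≠ 0) (hg : g ^ n ∈ (algebraMap K E).range) :
    ∃ j < p, ∃ c : K, g = algebraMap K E c * α ^ j := by
  obtain ⟨c, hc⟩ := hαp
  obtain ⟨d, hd⟩ := hg
  have hα0 : α ≠ 0 := fun h => hα (h ▸ zero_mem _)
  obtain ⟨σ, hσp, hσ⟩ := exists_aut_of_adjoin_root_eq_top hp hζ hα hc.symm htop
  obtain ⟨ω, hω⟩ : ∃ ω : E, σ g = ω * g := ⟨σ g / g, (div_mul_cancel₀ _ hg0).symm⟩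
  have hωn : ω ^ n = 1 := by
    have : (σ g) ^ n = g ^ n := by rw [← map_pow, ← hd, AlgEquiv.commutes]
    rw [hω, mul_pow] at this
    exact (mul_eq_right₀ (pow_ne_zero _ hg0)).1 this
  have hω0 : ω ≠ 0 := by rintro rfl; simp [hn] at hωn
  have hωK : ω ∈ (algebraMap K E).range := by
    by_contra hωK
    obtain ⟨m, q, hq, hqn, hm, hmq⟩ := Set.exists_prime_pow_mem ((algebraMap K E).range : Set E) hn
      hωK (by rw [hωn]; exact one_mem (algebraMap K E).range)
    obtain ⟨e, he⟩ := hmq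
    obtain ⟨ξ, hξ⟩ := hroots q hq hqn
    have hω'0 : ω ^ m ≠ 0 := pow_ne_zero _ hω0
    have hgm : σ (g ^ m) = ω ^ m * g ^ m := by rw [map_pow, hω, mul_pow]
    obtain ⟨i, -, hi⟩ := hξ.mem_range_algebraMap_of_pow_eq_one (E := E) hq.ne_zero
      (x := σ (ω ^ m) / ω ^ m) (by
        rw [div_pow, ← map_pow, ← he, AlgEquiv.commutes, div_self]
        exact he ▸ pow_ne_zero _ hω'0)
    set η := ξ ^ i
    have hσω : σ (ω ^ m) = algebraMap K E η * ω ^ m := (div_eq_iff hω'0).1 hi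
    have hηq : η ^ q = 1 := by rw [← pow_mul, mul_comm, pow_mul, hξ.pow_eq_one, one_pow]
    have hη1 : η ≠ 1 := fun h => hm (hσ _ (by simpa [h] using hσω))
    have hηp : η ^ p = 1 := by
      have := σ.iterate_apply_of_apply_eq_mul (g := ω ^ m) (ω := algebraMap K E η) (η := 1) hσω
        (by simp) p
      rw [hσp] at this
      apply (algebraMap K E).injective
      simpa [hω'0, eq_comm] using this
    have hqp : q = p := by
      rw [← orderOf_eq_prime_iff (hp := ⟨hq⟩) |>.2 ⟨hηq, hη1⟩,
        orderOf_eq_prime_iff (hp := ⟨hp⟩) |>.2 ⟨hηp, hη1⟩]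
    subst hqp
    have key := σ.iterate_apply_of_apply_eq_mul hgm hσω q
    rw [hσp, AlgEquiv.one_apply, eq_comm, mul_eq_right₀ (pow_ne_zero _ hg0)] at key
    apply hm
    rcases hq.eq_two_or_odd' with rfl | hodd
    · have h4' : (ω ^ m) ^ 4 = 1 := by
        have hη : algebraMap K E η ^ 2 = 1 := by rw [← map_pow, hηq, map_one]
        have : (ω ^ m) ^ 4 = (algebraMap K E η ^ Nat.choose 2 2 * (ω ^ m) ^ 2) ^ 2 := by
          rw [mul_pow, Nat.choose_self, pow_one, hη]; ring
        rw [this, key, one_pow]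
      by_cases h : 4 ∣ n
      · obtain ⟨ι, hι⟩ := h4 h
        obtain ⟨j, -, hj⟩ := hι.mem_range_algebraMap_of_pow_eq_one (E := E) four_ne_zero h4'
        exact ⟨_, hj.symm⟩
      · have h2 : (ω ^ m) ^ 2 = 1 := by
          have hgcd : Nat.gcd 4 n = 2 := by
            have h1 : Nat.gcd 4 n ∣ 4 := Nat.gcd_dvd_left _ _
            have h2 : 2 ∣ Nat.gcd 4 n := Nat.dvd_gcd (by norm_num) hqn
            have h3 : Nat.gcd 4 n ≠ 4 := fun h' => h (h' ▸ Nat.gcd_dvd_right 4 n)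
            have := Nat.le_of_dvd (by norm_num) h1
            interval_cases Nat.gcd 4 n <;> omega
          rw [← hgcd, pow_gcd_eq_one]
          exact ⟨h4', by rw [← pow_mul, mul_comm, pow_mul, hωn, one_pow]⟩
        obtain ⟨j, -, hj⟩ := hξ.mem_range_algebraMap_of_pow_eq_one (E := E) two_ne_zero h2
        exact ⟨_, hj.symm⟩
    · have hch : q ∣ q.choose 2 := by
        refine hq.dvd_choose_self two_ne_zero (lt_of_le_of_ne hq.two_le ?_)
        rintro rfl
        exact absurd hodd (by decide)
      obtain ⟨t, ht⟩ := hch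
      have h1 : (ω ^ m) ^ q = 1 := by
        rwa [ht, pow_mul, ← map_pow, hηq, map_one, one_pow, one_mul] at key
      obtain ⟨j, -, hj⟩ := hξ.mem_range_algebraMap_of_pow_eq_one (E := E) hq.ne_zero h1
      exact ⟨_, hj.symm⟩
  obtain ⟨w, rfl⟩ := hωK
  have hwp : w ^ p = 1 := by
    have := σ.iterate_apply_of_apply_eq_mul (η := 1) hω (by simp) p
    rw [hσp] at this
    apply (algebraMap K E).injective
    simpa [hg0, eq_comm] using this
  obtain ⟨i, -, hi⟩ := hζ.mem_range_algebraMap_of_pow_eq_one (E := E) hp.ne_zero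
    (x := σ α / α) (by
      rw [div_pow, ← map_pow, ← hc, AlgEquiv.commutes, div_self]
      exact hc ▸ pow_ne_zero _ hα0)
  set η := ζ ^ i
  have hσα : σ α = algebraMap K E η * α := (div_eq_iff hα0).1 hi
  have hη : IsPrimitiveRoot η p := by
    have hη1 : η ≠ 1 := fun h => hα (hσ _ (by simpa [h] using hσα))
    rw [IsPrimitiveRoot.iff_orderOf]
    refine orderOf_eq_prime_iff (hp := ⟨hp⟩) |>.2 ⟨?_, hη1⟩
    rw [← pow_mul, mul_comm, pow_mul, hζ.pow_eq_one, one_pow]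
  have : NeZero p := ⟨hp.ne_zero⟩
  obtain ⟨j, hj, rfl⟩ := hη.eq_pow_of_pow_eq_one hwp
  obtain ⟨b, hb⟩ := hσ (g / α ^ j) (by
    have hη0 : algebraMap K E η ≠ 0 := by simpa using hη.ne_zero hp.ne_zero
    rw [map_div₀, map_pow, hω, hσα, map_pow, mul_pow, mul_div_mul_left _ _ (pow_ne_zero _ hη0)])
  exact ⟨j, hj, b, by rw [hb, div_mul_cancel₀ _ (pow_ne_zero _ hα0)]⟩

theorem mem_fieldUnitsRange {K F : Type*} [Field K] [Field F] [Algebra K F] {u : Fˣ} :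
    u ∈ fieldUnitsRange K F ↔ (u : F) ∈ (algebraMap K F).range := by
  constructor
  · rintro ⟨c, rfl⟩
    exact ⟨c, rfl⟩
  · rintro ⟨c, hc⟩
    have hc0 : c ≠ 0 := by
      rintro rfl
      exact u.ne_zero (by rw [← hc, map_zero])
    exact ⟨Units.mk0 c hc0, Units.ext hc⟩

theorem fieldUnitsRange_le (K E F : Type*) [Field K] [Field E] [Field F] [Algebra K E]
    [Algebra E F] [Algebra K F] [IsScalarTower K E F] :
    fieldUnitsRange K F ≤ fieldUnitsRange E F := by
  intro u hu
  rw [mem_fieldUnitsRange] at hu ⊢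
  obtain ⟨c, hc⟩ := hu
  exact ⟨algebraMap K E c, by rw [← hc, IsScalarTower.algebraMap_apply K E F]⟩

/-- Linear independence of a family of units depends only on the classes modulo `Kˣ`. -/
theorem LinearIndependent.of_div_mem_fieldUnitsRange {K F ι κ : Type*} [Field K] [Field F]
    [Algebra K F] {w : κ → F} (hw : LinearIndependent K w) {v : ι → Fˣ}
    (hv : ∀ i j, v i / v j ∈ fieldUnitsRange K F → i = j)
    (h : ∀ i, ∃ j, ∃ c : K, (v i : F) = algebraMap K F c * w j) :
    LinearIndependent K fun i => (v i : F) := by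
  choose f c hc using h
  have hc0 : ∀ i, c i ≠ 0 := fun i hi => (v i).ne_zero (by rw [hc, hi, map_zero, zero_mul])
  have hf : Function.Injective f := by
    intro i j hij
    refine hv i j (mem_fieldUnitsRange.2 ⟨c i / c j, ?_⟩)
    have hw0 : w (f j) ≠ 0 := hw.ne_zero _
    rw [Units.val_div_eq_div_val, hc i, hc j, hij, mul_div_mul_right _ _ hw0, map_div₀]
  convert! (hw.comp f hf).units_smul fun i => Units.mk0 (c i) (hc0 i) using 1
  funext i
  simp [hc i, Algebra.smul_def, Units.smul_def]

theorem linearIndependent_of_mem_fieldUnitsRange {K F ι : Type*} [Field K] [Field F]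
    [Algebra K F] {v : ι → Fˣ} (hvK : ∀ i, v i ∈ fieldUnitsRange K F)
    (hv : ∀ i j, v i / v j ∈ fieldUnitsRange K F → i = j) :
    LinearIndependent K fun i => (v i : F) := by
  have : Subsingleton ι := ⟨fun i j => hv i j (div_mem (hvK i) (hvK j))⟩
  exact linearIndependent_subsingleton_index_iff _ |>.2 fun i => (v i).ne_zero

/-- Representatives of the cosets of `A` in `H`. -/
theorem Subgroup.exists_transversal {M : Type*} [CommGroup M] (A H : Subgroup M) :
    ∃ w : H ⧸ A.subgroupOf H → M, (∀ i, w i ∈ H) ∧ (∀ i j, w i / w j ∈ A → i = j) ∧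
      ∀ g ∈ H, ∃ i, g / w i ∈ A := by
  refine ⟨fun i => (i.out : M), fun i => i.out.2, fun i j h => ?_, fun g hg => ?_⟩
  · rw [← QuotientGroup.out_eq' i, ← QuotientGroup.out_eq' j, eq_comm, QuotientGroup.eq_iff_div_mem]
    rw [← inv_mem_iff, Subgroup.mem_subgroupOf]
    simpa using h
  · refine ⟨QuotientGroup.mk ⟨g, hg⟩, ?_⟩
    have := QuotientGroup.eq_iff_div_mem.1
      (QuotientGroup.out_eq' (QuotientGroup.mk ⟨g, hg⟩ : H ⧸ A.subgroupOf H)).symm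
    simpa [Subgroup.mem_subgroupOf] using this

open IntermediateField in
/-- Kneser's criterion when the base field contains all the relevant roots of unity. -/
theorem linearIndependent_of_primitiveRoots {F : Type u} [Field F] {n : ℕ} (hn : n ≠ 0)
    (H : Subgroup Fˣ) (m : ℕ) (hm : m ≠ 0) :
    ∀ (K : Type u) [Field K] [Algebra K F], (fieldUnitsRange K F).relIndex H = m →
      (∀ g ∈ H, g ^ n ∈ fieldUnitsRange K F) →
      (∀ q : ℕ, q.Prime → q ∣ n → ∃ ζ : K, IsPrimitiveRoot ζ q) →
      (4 ∣ n → ∃ ζ : K, IsPrimitiveRoot ζ 4) →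
      ∀ {ι : Type u} (v : ι → Fˣ), (∀ i, v i ∈ H) →
        (∀ i j, v i / v j ∈ fieldUnitsRange K F → i = j) →
        LinearIndependent K fun i => (v i : F) := by
  induction m using Nat.strong_induction_on with
  | _ m ih =>
  intro K _ _ hrel hpow hroots h4 ι v hvH hv
  by_cases hH : H ≤ fieldUnitsRange K F
  · exact linearIndependent_of_mem_fieldUnitsRange (fun i => hH (hvH i)) hv
  obtain ⟨g, hgH, hg⟩ := SetLike.not_le_iff_exists.1 hH
  obtain ⟨s, p, hp, hpn, ha, hap⟩ :=
    Set.exists_prime_pow_mem (fieldUnitsRange K F : Set Fˣ) hn hg (hpow g hgH)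
  have haH : g ^ s ∈ H := pow_mem hgH s
  generalize g ^ s = a at ha hap haH
  obtain ⟨ζ, hζ⟩ := hroots p hp hpn
  let E := K⟮(a : F)⟯
  have hKE : fieldUnitsRange K F ≤ fieldUnitsRange E F := fieldUnitsRange_le K E F
  have haE : a ∈ fieldUnitsRange E F := mem_fieldUnitsRange.2 ⟨AdjoinSimple.gen K (a : F), rfl⟩
  have hmul := Subgroup.relIndex_inf_mul_relIndex (fieldUnitsRange K F) (fieldUnitsRange E F) H
  rw [inf_of_le_left hKE, hrel] at hmul
  have hE0 : (fieldUnitsRange E F).relIndex H ≠ 0 := by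
    intro h
    rw [h, mul_zero] at hmul
    exact hm hmul.symm
  have hlt : (fieldUnitsRange E F).relIndex H < m := by
    have h1 : (fieldUnitsRange K F).relIndex (fieldUnitsRange E F ⊓ H) ≠ 1 := fun h =>
      ha (Subgroup.relIndex_eq_one.1 h ⟨haE, haH⟩)
    have h0 : (fieldUnitsRange K F).relIndex (fieldUnitsRange E F ⊓ H) ≠ 0 := by
      intro h
      rw [h, zero_mul] at hmul
      exact hm hmul.symm
    rw [← hmul]
    exact lt_mul_left (Nat.pos_of_ne_zero hE0) (by omega)
  obtain ⟨w, hwH, hw, hcover⟩ := Subgroup.exists_transversal (fieldUnitsRange E F) H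
  have hmapE : ∀ {q : ℕ}, (∃ ζ : K, IsPrimitiveRoot ζ q) → ∃ ζ : E, IsPrimitiveRoot ζ q :=
    fun ⟨ζ, hζ⟩ => ⟨_, hζ.map_of_injective (algebraMap K E).injective⟩
  have hwli := ih _ hlt hE0 E rfl (fun g hg => hKE (hpow g hg))
    (fun q hq hqn => hmapE (hroots q hq hqn)) (fun h => hmapE (h4 h)) w hwH hw
  set α : E := AdjoinSimple.gen K (a : F)
  have hαa : algebraMap E F α = a := rfl
  have hrange : ∀ x : E, algebraMap E F x ∈ (algebraMap K F).range → x ∈ (algebraMap K E).range := by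
    rintro x ⟨c, hc⟩
    exact ⟨c, (algebraMap E F).injective (by rw [← hc, ← IsScalarTower.algebraMap_apply])⟩
  have hα : α ∉ (algebraMap K E).range := by
    rintro ⟨c, hc⟩
    exact ha (mem_fieldUnitsRange.2
      ⟨c, by rw [← hαa, ← hc, ← IsScalarTower.algebraMap_apply]⟩)
  have hαp : α ^ p ∈ (algebraMap K E).range := hrange _ (by
    rw [map_pow, hαa]
    exact mem_fieldUnitsRange.1 hap)
  have htop : K⟮α⟯ = ⊤ := by
    apply lift_injective
    rw [lift_adjoin_simple, lift_top]
    rfl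
  have hpowli : LinearIndependent K fun j : Fin p => α ^ (j : ℕ) := by
    obtain ⟨c, hc⟩ := hαp
    have hirr := irreducible_X_pow_sub_C_of_notMem_range hp
      (fun b _ h => let ⟨j, _, h⟩ := hζ.mem_range_algebraMap_of_pow_eq_one hp.ne_zero h
        ⟨ζ ^ j, h.symm⟩) hα hc.symm
    have hmin := hirr.minpoly_eq_X_pow_sub_C hp.ne_zero hc.symm
    have hdeg : (minpoly K α).natDegree = p := by rw [hmin, Polynomial.natDegree_X_pow_sub_C]
    have := linearIndependent_pow (K := K) α
    rwa [hdeg] at this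
  refine (linearIndependent_smul hpowli hwli).of_div_mem_fieldUnitsRange hv fun i => ?_
  obtain ⟨k, hk⟩ := hcover (v i) (hvH i)
  obtain ⟨x, hx⟩ := mem_fieldUnitsRange.1 hk
  have hx0 : x ≠ 0 := by
    rintro rfl
    exact (v i / w k).ne_zero (by rw [← hx, map_zero])
  obtain ⟨j, hj, c, rfl⟩ := exists_eq_mul_pow_of_pow_mem_range hp hζ hα hαp htop hn hroots h4 hx0
    (hrange _ (by
      rw [map_pow, hx, ← Units.val_pow_eq_pow_val]
      exact mem_fieldUnitsRange.1 (hpow _ (div_mem (hvH i) (hwH k)))))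
  refine ⟨(⟨j, hj⟩, k), c, ?_⟩
  rw [Units.val_div_eq_div_val, eq_div_iff (w k).ne_zero] at hx
  rw [← hx, Algebra.smul_def, map_mul, ← IsScalarTower.algebraMap_apply, mul_assoc]

theorem mem_fieldUnitsRange_of_coprime_finrank {K E F : Type*} [Field K] [Field E] [Field F]
    [Algebra K E] [Algebra E F] [Algebra K F] [IsScalarTower K E F] [FiniteDimensional K E]
    {p : ℕ} (hp : p.Prime) (hcop : (Module.finrank K E).Coprime p) (H : Subgroup Fˣ)
    (hroots : ∀ g ∈ H ⊔ fieldUnitsRange K F, IsPrimitiveRoot (g : F) p →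
      ∃ ζ : K, IsPrimitiveRoot ζ p)
    {e : ℕ} {g : Fˣ} (hgH : g ∈ H) (hge : g ^ p ^ e ∈ fieldUnitsRange K F)
    (hgE : g ∈ fieldUnitsRange E F) : g ∈ fieldUnitsRange K F := by
  by_contra hg
  obtain ⟨s, q, hq, hqp, ha, haq⟩ := Set.exists_prime_pow_mem (fieldUnitsRange K F : Set Fˣ)
    (pow_ne_zero e hp.ne_zero) hg hge
  obtain rfl := (Nat.prime_dvd_prime_iff_eq hq hp).1 (hq.dvd_of_dvd_pow hqp)
  have haH : g ^ s ∈ H := pow_mem hgH s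
  have haE : g ^ s ∈ fieldUnitsRange E F := pow_mem hgE s
  generalize g ^ s = a at ha haq haH haE
  obtain ⟨x, hx⟩ := mem_fieldUnitsRange.1 haE
  obtain ⟨c, hc⟩ := mem_fieldUnitsRange.1 haq
  have hxK : x ∉ (algebraMap K E).range := by
    rintro ⟨b, rfl⟩
    exact ha (mem_fieldUnitsRange.2 ⟨b, by rw [← hx, ← IsScalarTower.algebraMap_apply]⟩)
  have hxc : x ^ q = algebraMap K E c := by
    apply (algebraMap E F).injective
    rw [map_pow, hx, ← IsScalarTower.algebraMap_apply, hc, Units.val_pow_eq_pow_val]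
  have hirr := irreducible_X_pow_sub_C_of_notMem_range hq (fun b hb h => by
    by_cases h1 : x / algebraMap K E b = 1
    · exact h1 ▸ one_mem _
    have hprim : IsPrimitiveRoot (x / algebraMap K E b) q :=
      IsPrimitiveRoot.iff_orderOf.2 (orderOf_eq_prime (hp := ⟨hq⟩) h h1)
    have hb0 : algebraMap K F b ≠ 0 := by simpa using hb
    obtain ⟨ζ, hζ⟩ := hroots (a / Units.mk0 _ hb0)
      (div_mem (Subgroup.mem_sup_left haH)
        (Subgroup.mem_sup_right (mem_fieldUnitsRange.2 ⟨b, rfl⟩))) (by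
      have := hprim.map_of_injective (algebraMap E F).injective
      rw [Units.val_div_eq_div_val, Units.val_mk0]
      rwa [map_div₀, hx, ← IsScalarTower.algebraMap_apply] at this)
    obtain ⟨j, -, hj⟩ := hζ.mem_range_algebraMap_of_pow_eq_one hq.ne_zero h
    exact ⟨_, hj.symm⟩) hxK hxc
  have hdvd : (minpoly K x).natDegree ∣ Module.finrank K E :=
    minpoly.degree_dvd (Algebra.IsIntegral.isIntegral x)
  rw [hirr.minpoly_eq_X_pow_sub_C hq.ne_zero hxc, Polynomial.natDegree_X_pow_sub_C] at hdvd
  exact hq.one_lt.ne' (Nat.Coprime.eq_one_of_dvd hcop.symm hdvd)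

open IntermediateField in
theorem toSubmodule_adjoin_units_eq_span (K : Type*) {F ι : Type*} [Field K] [Field F]
    [Algebra K F] (H : Subgroup Fˣ) (hpow : ∀ g ∈ H, ∃ n ≠ 0, g ^ n ∈ fieldUnitsRange K F)
    {v : ι → Fˣ} (hvH : ∀ i, v i ∈ H) (hcover : ∀ g ∈ H, ∃ i, g / v i ∈ fieldUnitsRange K F) :
    Subalgebra.toSubmodule (adjoin K ((fun u : Fˣ => (u : F)) '' (H : Set Fˣ))).toSubalgebra =
      Submodule.span K (Set.range fun i => (v i : F)) := by
  have halg : ∀ x ∈ (fun u : Fˣ => (u : F)) '' (H : Set Fˣ), IsAlgebraic K x := by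
    rintro _ ⟨g, hg, rfl⟩
    obtain ⟨n, hn, hgn⟩ := hpow g hg
    obtain ⟨c, hc⟩ := mem_fieldUnitsRange.1 hgn
    refine IsIntegral.isAlgebraic (IsIntegral.of_pow (Nat.pos_of_ne_zero hn) ?_)
    rw [← Units.val_pow_eq_pow_val, ← hc]
    exact isIntegral_algebraMap
  have hclosure : ((Submonoid.closure ((fun u : Fˣ => (u : F)) '' (H : Set Fˣ)) :
      Submonoid F) : Set F) = (fun u : Fˣ => (u : F)) '' (H : Set Fˣ) :=
    congrArg SetLike.coe (Submonoid.closure_eq (H.toSubmonoid.map (Units.coeHom F)))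
  rw [adjoin_toSubalgebra_of_isAlgebraic halg, Algebra.adjoin_eq_span, hclosure]
  refine le_antisymm (Submodule.span_le.2 ?_) (Submodule.span_mono ?_)
  · rintro _ ⟨g, hg, rfl⟩
    obtain ⟨i, hi⟩ := hcover g hg
    obtain ⟨c, hc⟩ := mem_fieldUnitsRange.1 hi
    rw [Units.val_div_eq_div_val, eq_div_iff (v i).ne_zero, ← Algebra.smul_def] at hc
    dsimp only
    rw [← hc]
    exact Submodule.smul_mem _ _ (Submodule.subset_span ⟨i, rfl⟩)
  · rintro _ ⟨i, rfl⟩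
    exact ⟨v i, hvH i, rfl⟩

open IntermediateField in
theorem coprime_finrank_adjoin_primitiveRoot {E F : Type*} [Field E] [Field F] [Algebra E F]
    {p : ℕ} (hp : p.Prime) {ζ : F} (hζ : IsPrimitiveRoot ζ p) :
    (Module.finrank E E⟮ζ⟯).Coprime p := by
  have hint : IsIntegral E ζ := (hζ.isIntegral hp.pos).tower_top
  rw [adjoin.finrank hint]
  have : NeZero (p : F) := have : NeZero p := ⟨hp.ne_zero⟩; hζ.neZero'
  have hdvd : minpoly E ζ ∣ Polynomial.cyclotomic p E := minpoly.dvd _ _ (by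
    rw [Polynomial.aeval_def, ← Polynomial.eval_map, Polynomial.map_cyclotomic]
    exact hζ.isRoot_cyclotomic hp.pos)
  have hle := Polynomial.natDegree_le_of_dvd hdvd (Polynomial.cyclotomic_ne_zero p E)
  rw [Polynomial.natDegree_cyclotomic, Nat.totient_prime hp] at hle
  have hpos := minpoly.natDegree_pos hint
  exact (Nat.coprime_of_lt_prime hpos.ne' (by have := hp.pos; omega) hp).symm

open IntermediateField in
/-- A finite extension of degree prime to `p` enlarges to one containing a primitive `p`-th root of
unity. -/
theorem IntermediateField.exists_coprime_finrank_primitiveRoot_mem {K F : Type*} [Field K] [Field F]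
    [Algebra K F] {p : ℕ} (hp : p.Prime) {ζ : F} (hζ : IsPrimitiveRoot ζ p)
    (E : IntermediateField K F) [FiniteDimensional K E] (hE : (Module.finrank K E).Coprime p) :
    ∃ L : IntermediateField K F, E ≤ L ∧ ζ ∈ L ∧ FiniteDimensional K L ∧
      (Module.finrank K L).Coprime p := by
  have hint : IsIntegral E ζ := ⟨Polynomial.X ^ p - 1, Polynomial.monic_X_pow_sub_C 1 hp.ne_zero,
    by simp [hζ.pow_eq_one]⟩
  have : FiniteDimensional E E⟮ζ⟯ := adjoin.finiteDimensional hint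
  have : Module.Free E E⟮ζ⟯ := Module.Free.of_divisionRing _ _
  refine ⟨E⟮ζ⟯.restrictScalars K, fun x hx => ?_, mem_adjoin_simple_self E ζ,
    Module.Finite.trans (R := K) E E⟮ζ⟯, ?_⟩
  · exact E⟮ζ⟯.algebraMap_mem ⟨x, hx⟩
  · have h := (Module.finrank_mul_finrank K E E⟮ζ⟯).symm
    have h' := Nat.Coprime.mul_left hE (coprime_finrank_adjoin_primitiveRoot (E := E) hp hζ)
    rw [← h] at h'
    exact h'

theorem Subgroup.coprime_relIndex_of_pow_mem {M : Type*} [CommGroup M] (A H : Subgroup M)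
    {n p : ℕ} (hp : p.Prime) (hpn : ¬ p ∣ n) (hfin : A.relIndex H ≠ 0)
    (hpow : ∀ g ∈ H, g ^ n ∈ A) : (A.relIndex H).Coprime p := by
  refine ((Nat.Prime.coprime_iff_not_dvd hp).2 fun h => hpn ?_).symm
  have : Finite (H ⧸ A.subgroupOf H) := Nat.finite_of_card_ne_zero hfin
  obtain ⟨x, hx⟩ := exists_prime_orderOf_dvd_card' (hp := ⟨hp⟩) p h
  rw [← hx]
  refine orderOf_dvd_of_pow_eq_one ?_
  induction x using QuotientGroup.induction_on with
  | H g =>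
    rw [← QuotientGroup.mk_pow, QuotientGroup.eq_one_iff, Subgroup.mem_subgroupOf]
    exact hpow g g.2

open IntermediateField in
/-- Kneser's criterion over an algebraically closed field. -/
theorem linearIndependent_of_pow_mem {K : Type*} {F : Type u} [Field K] [Field F] [Algebra K F]
    [IsAlgClosed F] (n : ℕ) :
    ∀ (H : Subgroup Fˣ), (n : K) ≠ 0 → (fieldUnitsRange K F).relIndex H ≠ 0 →
      (∀ g ∈ H, g ^ n ∈ fieldUnitsRange K F) →
      (∀ p : ℕ, p.Prime → p ∣ n → ∀ g ∈ H ⊔ fieldUnitsRange K F, IsPrimitiveRoot (g : F) p →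
        ∃ ζ : K, IsPrimitiveRoot ζ p) →
      (4 ∣ n → ∃ ζ : K, IsPrimitiveRoot ζ 4) →
      ∀ {ι : Type u} (v : ι → Fˣ), (∀ i, v i ∈ H) →
        (∀ i j, v i / v j ∈ fieldUnitsRange K F → i = j) →
        LinearIndependent K fun i => (v i : F) := by
  induction n using Nat.recOnPrimePow with
  | zero => exact fun _ h => absurd Nat.cast_zero h
  | one =>
    intro H _ _ hpow _ _ ι v hvH hv
    exact linearIndependent_of_mem_fieldUnitsRange (fun i => by simpa using hpow _ (hvH i)) hv
  | prime_pow_mul a p e hp hpa he ih =>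
    intro H hnK hfin hpow hroots h4 ι v hvH hv
    rw [Nat.cast_mul, Nat.cast_pow, mul_ne_zero_iff] at hnK
    have hpF : NeZero (p : F) := ⟨by
      have := (pow_ne_zero_iff he.ne').1 hnK.1
      rwa [← map_natCast (algebraMap K F), map_ne_zero]⟩
    obtain ⟨ζ, hζ⟩ := HasEnoughRootsOfUnity.exists_primitiveRoot F p
    let H₁ := H ⊓ (fieldUnitsRange K F).comap (powMonoidHom a)
    let H₂ := H ⊓ (fieldUnitsRange K F).comap (powMonoidHom (p ^ e))
    have hfin₁ : (fieldUnitsRange K F).relIndex H₁ ≠ 0 :=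
      mt (Subgroup.relIndex_eq_zero_of_le_right inf_le_left) hfin
    have hfin₂ : (fieldUnitsRange K F).relIndex H₂ ≠ 0 :=
      mt (Subgroup.relIndex_eq_zero_of_le_right inf_le_left) hfin
    have hpow₁ : ∀ g ∈ H₁, g ^ a ∈ fieldUnitsRange K F := fun g hg => hg.2
    have hpow₂ : ∀ g ∈ H₂, g ^ p ^ e ∈ fieldUnitsRange K F := fun g hg => hg.2
    obtain ⟨w₁, hwH₁, hw₁, hcover₁⟩ := Subgroup.exists_transversal (fieldUnitsRange K F) H₁
    obtain ⟨w₂, hwH₂, hw₂, hcover₂⟩ := Subgroup.exists_transversal (fieldUnitsRange K F) H₂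
    have hli₁ := ih H₁ hnK.2 hfin₁ hpow₁
      (fun q hq hqa g hg => hroots q hq (hqa.mul_left _) g
        (sup_le_sup_right (inf_le_left : H₁ ≤ H) _ hg)) (fun h => h4 (h.mul_left _)) w₁ hwH₁ hw₁
    have ha0 : a ≠ 0 := by rintro rfl; simp at hpa
    let E := adjoin K ((fun u : Fˣ => (u : F)) '' (H₁ : Set Fˣ))
    have hspan := toSubmodule_adjoin_units_eq_span K H₁ (fun g hg => ⟨a, ha0, hpow₁ g hg⟩) hwH₁
      hcover₁
    have hrankE : Module.finrank K E = (fieldUnitsRange K F).relIndex H₁ := by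
      have : Finite (H₁ ⧸ (fieldUnitsRange K F).subgroupOf H₁) := Nat.finite_of_card_ne_zero hfin₁
      have := Fintype.ofFinite (H₁ ⧸ (fieldUnitsRange K F).subgroupOf H₁)
      have h := finrank_span_eq_card hli₁
      rw [← hspan, ← Nat.card_eq_fintype_card] at h
      exact h
    have : FiniteDimensional K E := Module.finite_of_finrank_pos (hrankE ▸ Nat.pos_of_ne_zero hfin₁)
    obtain ⟨L, hEL, hζL, hLfin, hcop⟩ := E.exists_coprime_finrank_primitiveRoot_mem hp hζ
      (hrankE ▸ Subgroup.coprime_relIndex_of_pow_mem _ _ hp hpa hfin₁ hpow₁)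
    have hKE : fieldUnitsRange K F ≤ fieldUnitsRange L F := fieldUnitsRange_le K L F
    have hli₂ : LinearIndependent L fun i => (w₂ i : F) := by
      refine linearIndependent_of_primitiveRoots (pow_ne_zero e hp.ne_zero) H₂ _
        (mt (Subgroup.relIndex_eq_zero_of_le_left hKE) hfin₂) L rfl
        (fun g hg => hKE (hpow₂ g hg)) (fun q hq hqp => ?_) (fun h => ?_) w₂ hwH₂
        (fun i j hij => hw₂ i j ?_)
      · obtain rfl := (Nat.prime_dvd_prime_iff_eq hq hp).1 (hq.dvd_of_dvd_pow hqp)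
        exact ⟨⟨ζ, hζL⟩, IsPrimitiveRoot.of_map_of_injective
          (f := algebraMap L F) hζ (algebraMap L F).injective⟩
      · obtain ⟨ξ, hξ⟩ := h4 (h.mul_right _)
        exact ⟨_, hξ.map_of_injective (algebraMap K L).injective⟩
      · have hmem := div_mem (hwH₂ i) (hwH₂ j)
        exact mem_fieldUnitsRange_of_coprime_finrank hp hcop H₂
          (fun g hg => hroots p hp ((dvd_pow_self p he.ne').mul_right _) g
            (sup_le_sup_right (inf_le_left : H₂ ≤ H) _ hg)) hmem (hpow₂ _ hmem) hij
    have hw₁E : ∀ i, ∃ x : L, algebraMap L F x = w₁ i := fun i =>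
      ⟨⟨w₁ i, hEL (subset_adjoin _ _ ⟨w₁ i, hwH₁ i, rfl⟩)⟩, rfl⟩
    choose x hx using hw₁E
    have hlix : LinearIndependent K x := by
      refine LinearIndependent.of_comp (IsScalarTower.toAlgHom K L F).toLinearMap ?_
      convert! hli₁ using 1
      funext i
      exact hx i
    refine (linearIndependent_smul hlix hli₂).of_div_mem_fieldUnitsRange hv fun i => ?_
    have hcopn : IsCoprime (a : ℤ) ((p ^ e : ℕ) : ℤ) :=
      Nat.isCoprime_iff_coprime.2 (((Nat.Prime.coprime_iff_not_dvd hp).2 hpa).symm.pow_right e)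
    obtain ⟨r, s, hrs⟩ := hcopn
    have hvn : (v i ^ (p ^ e)) ^ a ∈ fieldUnitsRange K F := by
      rw [← pow_mul]; exact hpow _ (hvH i)
    have h₁ : v i ^ (p ^ e) ∈ H₁ := ⟨pow_mem (hvH i) _, hvn⟩
    have h₂ : v i ^ a ∈ H₂ := ⟨pow_mem (hvH i) _, by
      rw [← pow_mul, mul_comm, pow_mul] at hvn; exact hvn⟩
    obtain ⟨j, hj⟩ := hcover₁ _ (zpow_mem h₁ s)
    obtain ⟨k, hk⟩ := hcover₂ _ (zpow_mem h₂ r)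
    have hprod : v i / (w₁ j * w₂ k) ∈ fieldUnitsRange K F := by
      have h := mul_mem hj hk
      rwa [div_mul_div_comm, ← zpow_natCast, ← zpow_natCast (v i) a, ← zpow_mul, ← zpow_mul,
        ← zpow_add, show ((p ^ e : ℕ) : ℤ) * s + (a : ℤ) * r = 1 by linarith, zpow_one] at h
    obtain ⟨c, hc⟩ := mem_fieldUnitsRange.1 hprod
    refine ⟨(j, k), c, ?_⟩
    rw [Units.val_div_eq_div_val, eq_div_iff (w₁ j * w₂ k).ne_zero] at hc
    rw [← hc, Algebra.smul_def, hx, Units.val_mul]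

/-- Kneser's criterion for subgroups that are finite modulo the base field. -/
theorem linearIndependent_of_pow_mem_of_relIndex_ne_zero {K : Type*} {F : Type u} [Field K]
    [Field F] [Algebra K F] {n : ℕ} (hn : (n : K) ≠ 0) (H : Subgroup Fˣ)
    (hfin : (fieldUnitsRange K F).relIndex H ≠ 0) (hpow : ∀ g ∈ H, g ^ n ∈ fieldUnitsRange K F)
    (hroots : ∀ p : ℕ, p.Prime → p ∣ n → ∀ g ∈ H ⊔ fieldUnitsRange K F,
      IsPrimitiveRoot (g : F) p → ∃ ζ : K, IsPrimitiveRoot ζ p)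
    (h4 : 4 ∣ n → ∃ ζ : K, IsPrimitiveRoot ζ 4) {ι : Type u} (v : ι → Fˣ) (hvH : ∀ i, v i ∈ H)
    (hv : ∀ i j, v i / v j ∈ fieldUnitsRange K F → i = j) :
    LinearIndependent K fun i => (v i : F) := by
  let Ω := AlgebraicClosure F
  let φ : Fˣ →* Ωˣ := Units.map (algebraMap F Ω : F →+* Ω).toMonoidHom
  have hφ : Function.Injective φ := Units.map_injective (algebraMap F Ω).injective
  have hmap : fieldUnitsRange K Ω = (fieldUnitsRange K F).map φ := by
    rw [fieldUnitsRange, fieldUnitsRange, MonoidHom.map_range, ← Units.map_comp]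
    congr 2
  have hmem : ∀ g : Fˣ, φ g ∈ fieldUnitsRange K Ω ↔ g ∈ fieldUnitsRange K F := fun g => by
    rw [hmap, Subgroup.mem_map_iff_mem hφ]
  refine LinearIndependent.of_comp (IsScalarTower.toAlgHom K F Ω).toLinearMap
    (linearIndependent_of_pow_mem n (H.map φ) hn ?_ ?_ ?_ h4 (fun i => φ (v i))
      (fun i => ⟨v i, hvH i, rfl⟩) fun i j h => hv i j ?_)
  · rwa [hmap, Subgroup.relIndex_map_map_of_injective _ _ hφ]
  · rintro _ ⟨g, hg, rfl⟩
    rw [← map_pow, hmem]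
    exact hpow g hg
  · rw [hmap, ← Subgroup.map_sup]
    rintro p hp hpn _ ⟨g, hg, rfl⟩ hgp
    exact hroots p hp hpn g hg
      (IsPrimitiveRoot.of_map_of_injective (f := algebraMap F Ω) hgp (algebraMap F Ω).injective)
  · rwa [← map_div, hmem] at h

theorem Subgroup.orderOf_mk_subgroupOf_eq {M : Type*} [CommGroup M] (A : Subgroup M)
    {H G : Subgroup M} (h : H ≤ G) (g : H) :
    orderOf (g : H ⧸ A.subgroupOf H) =
      orderOf ((Subgroup.inclusion h g : G) : G ⧸ A.subgroupOf G) := by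
  refine orderOf_eq_orderOf_iff.2 fun n => ?_
  simp only [← QuotientGroup.mk_pow, QuotientGroup.eq_one_iff, Subgroup.mem_subgroupOf]
  rfl

/-- Kneser's criterion for subgroups that are torsion modulo the base field. -/
theorem linearIndependent_of_isOfFinOrder_quotient {K : Type*} {F : Type u} [Field K] [Field F]
    [Algebra K F] (G : Subgroup Fˣ)
    (htors : ∀ x : (G ⊔ fieldUnitsRange K F : Subgroup Fˣ) ⧸
        (fieldUnitsRange K F).subgroupOf (G ⊔ fieldUnitsRange K F), IsOfFinOrder x)
    (h4 : (∃ x : (G ⊔ fieldUnitsRange K F : Subgroup Fˣ) ⧸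
        (fieldUnitsRange K F).subgroupOf (G ⊔ fieldUnitsRange K F), orderOf x = 4) →
      ∃ ζ : K, IsPrimitiveRoot ζ 4)
    (hp : ∀ p : ℕ, p.Prime →
      (∃ g : (G ⊔ fieldUnitsRange K F : Subgroup Fˣ), IsOfFinOrder g ∧ p ∣ orderOf g) →
      (∃ x : (G ⊔ fieldUnitsRange K F : Subgroup Fˣ) ⧸
        (fieldUnitsRange K F).subgroupOf (G ⊔ fieldUnitsRange K F), p ∣ orderOf x ∧ x ≠ 1) →
      ∃ ζ : K, IsPrimitiveRoot ζ p)
    (hchar : ∀ p : ℕ, p.Prime →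
      (∃ x : (G ⊔ fieldUnitsRange K F : Subgroup Fˣ) ⧸
        (fieldUnitsRange K F).subgroupOf (G ⊔ fieldUnitsRange K F), p ∣ orderOf x ∧ x ≠ 1) →
      ringChar K ≠ p)
    {ι : Type u} (v : ι → Fˣ) (hvG : ∀ i, v i ∈ G)
    (hv : ∀ i j, v i / v j ∈ fieldUnitsRange K F → i = j) :
    LinearIndependent K fun i => (v i : F) := by
  refine linearIndependent_iff_finset_linearIndependent.2 fun s => ?_
  let H := Subgroup.closure (v '' (s : Set ι))
  have hHG : H ≤ G := (Subgroup.closure_le G).2 (by rintro _ ⟨i, -, rfl⟩; exact hvG i)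
  have hle : H ≤ G ⊔ fieldUnitsRange K F := hHG.trans le_sup_left
  let Q := H ⧸ (fieldUnitsRange K F).subgroupOf H
  have hord : ∀ y : Q, ∃ x : (G ⊔ fieldUnitsRange K F : Subgroup Fˣ) ⧸
      (fieldUnitsRange K F).subgroupOf (G ⊔ fieldUnitsRange K F), orderOf y = orderOf x := by
    intro y
    induction y using QuotientGroup.induction_on with
    | H g => exact ⟨_, Subgroup.orderOf_mk_subgroupOf_eq _ hle g⟩
  have hQtors : ∀ y : Q, IsOfFinOrder y := fun y => by
    obtain ⟨x, hx⟩ := hord y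
    rw [← orderOf_pos_iff, hx]
    exact (htors x).orderOf_pos
  have hHfg : Group.FG H := (Group.fg_iff_subgroup_fg H).2
    ((Subgroup.fg_iff H).2 ⟨_, rfl, s.finite_toSet.image v⟩)
  have hQfin : Finite Q := CommGroup.finite_of_fg_isMulTorsion Q hQtors
  obtain ⟨y, hy⟩ := Monoid.exists_orderOf_eq_exponent (Monoid.ExponentExists.of_finite (G := Q))
  have hn0 : Monoid.exponent Q ≠ 0 :=
    Monoid.exponent_ne_zero.2 (Monoid.ExponentExists.of_finite (G := Q))
  have hprime : ∀ p : ℕ, p.Prime → p ∣ Monoid.exponent Q →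
      ∃ x : (G ⊔ fieldUnitsRange K F : Subgroup Fˣ) ⧸
        (fieldUnitsRange K F).subgroupOf (G ⊔ fieldUnitsRange K F), p ∣ orderOf x ∧ x ≠ 1 := by
    intro p hpp hpn
    obtain ⟨x, hx⟩ := hord y
    rw [← hy, hx] at hpn
    refine ⟨x, hpn, ?_⟩
    rintro rfl
    exact hpp.one_lt.ne' (by simpa using hpn)
  refine linearIndependent_of_pow_mem_of_relIndex_ne_zero (n := Monoid.exponent Q) ?_ H ?_ ?_ ?_ ?_
    (fun i : s => v i) (fun i => Subgroup.subset_closure ⟨i, i.2, rfl⟩)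
    fun i j h => Subtype.ext (hv i j h)
  · intro h
    have hdvd := (ringChar.spec K _).1 h
    rcases CharP.char_is_prime_or_zero K (ringChar K) with hc | hc
    · exact hchar _ hc (hprime _ hc hdvd) rfl
    · rw [hc] at hdvd
      exact hn0 (zero_dvd_iff.1 hdvd)
  · exact Nat.card_pos (α := Q).ne'
  · intro g hg
    have := Monoid.pow_exponent_eq_one ((⟨g, hg⟩ : H) : Q)
    rwa [← QuotientGroup.mk_pow, QuotientGroup.eq_one_iff, Subgroup.mem_subgroupOf] at this
  · intro p hpp hpn g hg hgp
    have hord' : orderOf (⟨g, sup_le_sup_right hHG _ hg⟩ :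
        (G ⊔ fieldUnitsRange K F : Subgroup Fˣ)) = p := by
      rw [Subgroup.orderOf_mk, ← orderOf_units, ← hgp.eq_orderOf]
    exact hp p hpp ⟨_, orderOf_pos_iff.1 (hord' ▸ hpp.pos), hord'.symm.dvd⟩ (hprime p hpp hpn)
  · intro h
    obtain ⟨x, hx⟩ := hord (y ^ (orderOf y / 4))
    rw [← hy] at h
    refine h4 ⟨x, hx ▸ ?_⟩
    have hpos := (hQtors y).orderOf_pos
    rw [orderOf_pow_of_dvd (by have := Nat.le_of_dvd hpos h; omega) (Nat.div_dvd_of_dvd h),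
      Nat.div_div_self h hpos.ne']

open IntermediateField in
/-- Independence and spanning over a base field pass to intermediate fields equal to the base. -/
theorem iSupIndep_span_and_coe_iSup_of_eq_bot {K F ι : Type*} [Field K] [Field F] [Algebra K F]
    {B : IntermediateField K F} (hB : B = ⊥) {v : ι → F} (hv : LinearIndependent K v) :
    iSupIndep (fun i => (Submodule.span B {v i} : Submodule B F)) ∧
      ((⨆ i, Submodule.span B {v i} : Submodule B F) : Set F) =
        Submodule.span K (Set.range v) := by
  have hsurj : Function.Surjective (algebraMap K B) := by
    rintro ⟨x, hx⟩
    obtain ⟨c, rfl⟩ := mem_bot.1 (hB ▸ hx)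
    exact ⟨c, rfl⟩
  constructor
  · refine LinearIndependent.iSupIndep_span_singleton (linearIndependent_iff'.2 fun s g hg i hi => ?_)
    choose c hc using fun i => hsurj (g i)
    have h := linearIndependent_iff'.1 hv s c (by
      rw [← hg]
      exact Finset.sum_congr rfl fun j _ => by rw [← hc, algebraMap_smul]) i hi
    rw [← hc, h, map_zero]
  · rw [← Submodule.span_range_eq_iSup, ← Submodule.restrictScalars_span K B hsurj]
    rfl

/-- Corollary 1.4: `k(G) = ⊕_{t ∈ T} k(k* ∩ G)·t` for any transversal `T`
of `k* ∩ G` in `G`, where `G` need not contain `k*`. -/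
theorem adjoin_eq_directSum_over_transversal_of_inter
    (K F : Type*) [Field K] [Field F] [Algebra K F] (G : Subgroup Fˣ)
    -- the quotient group Gk*/k* is torsion
    (htors : ∀ x : (G ⊔ fieldUnitsRange K F : Subgroup Fˣ) ⧸
        (fieldUnitsRange K F).subgroupOf (G ⊔ fieldUnitsRange K F), IsOfFinOrder x)
    -- k contains a primitive 4th root of unity whenever Gk*/k* has an element of order 4
    (h4 : (∃ x : (G ⊔ fieldUnitsRange K F : Subgroup Fˣ) ⧸
        (fieldUnitsRange K F).subgroupOf (G ⊔ fieldUnitsRange K F), orderOf x = 4) →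
      ∃ ζ : K, IsPrimitiveRoot ζ 4)
    -- for every prime p in π(t(Gk*)) ∩ π(Gk*/k*), k contains a primitive p-th root of unity
    (hp : ∀ p : ℕ, p.Prime →
      (∃ g : (G ⊔ fieldUnitsRange K F : Subgroup Fˣ), IsOfFinOrder g ∧ p ∣ orderOf g) →
      (∃ x : (G ⊔ fieldUnitsRange K F : Subgroup Fˣ) ⧸
        (fieldUnitsRange K F).subgroupOf (G ⊔ fieldUnitsRange K F), p ∣ orderOf x ∧ x ≠ 1) →
      ∃ ζ : K, IsPrimitiveRoot ζ p)
    -- the characteristic of k does not belong to π(Gk*/k*)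
    (hchar : ∀ p : ℕ, p.Prime →
      (∃ x : (G ⊔ fieldUnitsRange K F : Subgroup Fˣ) ⧸
        (fieldUnitsRange K F).subgroupOf (G ⊔ fieldUnitsRange K F), p ∣ orderOf x ∧ x ≠ 1) →
      ringChar K ≠ p)
    -- T is a transversal to the subgroup k* ∩ G in G
    (T : Set Fˣ) (hTG : T ⊆ (G : Set Fˣ))
    (htrans : ∀ g ∈ G, ∃! t, t ∈ T ∧ t⁻¹ * g ∈ fieldUnitsRange K F ⊓ G) :
    iSupIndep (fun t : T =>
      (Submodule.span
        (IntermediateField.adjoin K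
          ((fun u : Fˣ => (u : F)) '' ((fieldUnitsRange K F ⊓ G : Subgroup Fˣ) : Set Fˣ)))
        {((t : Fˣ) : F)} : Submodule _ F)) ∧
    ((⨆ t : T, (Submodule.span
        (IntermediateField.adjoin K
          ((fun u : Fˣ => (u : F)) '' ((fieldUnitsRange K F ⊓ G : Subgroup Fˣ) : Set Fˣ)))
        {((t : Fˣ) : F)} : Submodule _ F) : Submodule _ F) : Set F) =
      ((IntermediateField.adjoin K ((fun u : Fˣ => (u : F)) '' (G : Set Fˣ))) : Set F) := by
  have hdiv : ∀ g ∈ G, ∃ i : T, g / (i : Fˣ) ∈ fieldUnitsRange K F := fun g hg => by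
    obtain ⟨t, ⟨htT, ht⟩, -⟩ := htrans g hg
    exact ⟨⟨t, htT⟩, by rw [div_eq_inv_mul]; exact ht.1⟩
  have hpow : ∀ g ∈ G, ∃ n ≠ 0, g ^ n ∈ fieldUnitsRange K F := fun g hg => by
    obtain ⟨n, hn, h⟩ := isOfFinOrder_iff_pow_eq_one.1 (htors (QuotientGroup.mk
      ⟨g, Subgroup.mem_sup_left hg⟩))
    rw [← QuotientGroup.mk_pow, QuotientGroup.eq_one_iff, Subgroup.mem_subgroupOf] at h
    exact ⟨n, hn.ne', h⟩
  have hli := linearIndependent_of_isOfFinOrder_quotient G htors h4 hp hchar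
    (fun t : T => (t : Fˣ)) (fun t => hTG t.2) fun i j h => by
      have hmem : (j : Fˣ)⁻¹ * i ∈ fieldUnitsRange K F ⊓ G :=
        ⟨by rwa [← div_eq_inv_mul], G.mul_mem (G.inv_mem (hTG j.2)) (hTG i.2)⟩
      exact Subtype.ext ((htrans i (hTG i.2)).unique
        ⟨i.2, by rw [inv_mul_cancel]; exact one_mem _⟩ ⟨j.2, hmem⟩)
  have hbot : IntermediateField.adjoin K
      ((fun u : Fˣ => (u : F)) '' ((fieldUnitsRange K F ⊓ G : Subgroup Fˣ) : Set Fˣ)) = ⊥ := by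
    rw [IntermediateField.adjoin_eq_bot_iff]
    rintro _ ⟨g, hg, rfl⟩
    exact IntermediateField.mem_bot.2 (mem_fieldUnitsRange.1 hg.1)
  obtain ⟨hind, hsup⟩ := iSupIndep_span_and_coe_iSup_of_eq_bot hbot hli
  refine ⟨hind, hsup.trans ?_⟩
  rw [← toSubmodule_adjoin_units_eq_span K G hpow (fun t : T => hTG t.2) hdiv]
  rfl
end

section
/- Let f be a finite extension of a field k with [f:k] = n, and suppose the field f is regular. Let f̄ = f*/t(f*) be the reduced multiplicative group of f and let k̄ denote the image of k* in f̄. Then f̄ is the internal direct product F × D, where F is a countable free abelian subgroup of f̄ and D = {x ∈ f̄ : x^n ∈ k̄} is the subgroup of elements of f̄ whose n-th power lies in k̄. -/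
/-- A field `k` is regular if it is countable and its multiplicative group is a direct
product of a torsion group and a free abelian group. -/
def IsRegularField (k : Type*) [Field k] : Prop :=
  Countable k ∧
    ∃ T Fr : Subgroup kˣ, (∀ x ∈ T, IsOfFinOrder x) ∧ Module.Free ℤ (Additive Fr) ∧
      T ⊓ Fr = ⊥ ∧ T ⊔ Fr = ⊤

/-- The reduced multiplicative group `f̄ = f*/t(f*)` of a field `f`. -/
abbrev reducedUnits (F : Type*) [Field F] := Fˣ ⧸ CommGroup.torsion Fˣ

/-- The image `k̄` of `k*` in the reduced multiplicative group `f̄`. -/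
def reducedImage (K F : Type*) [Field K] [Field F] [Algebra K F] :
    Subgroup (reducedUnits F) :=
  Subgroup.map (QuotientGroup.mk' (CommGroup.torsion Fˣ))
    ((Units.map (algebraMap K F : K →+* F).toMonoidHom).range)

/-- A submodule of a free module over a principal ideal domain is free. -/
theorem Submodule.free_of_isPrincipalIdealRing {R M : Type*} [CommRing R] [IsDomain R]
    [IsPrincipalIdealRing R] [AddCommGroup M] [Module R M] [Module.Free R M]
    (N : Submodule R M) : Module.Free R N := by
  classical
  obtain ⟨ι, b⟩ := Module.Free.exists_basis (R := R) (M := M)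
  obtain ⟨_, _⟩ := exists_wellFoundedLT ι
  let S : ι → Submodule R M := fun i =>
    N ⊓ (Finsupp.supported R R (Set.Iic i)).comap b.repr.toLinearMap
  have hS : ∀ i x, x ∈ S i ↔ x ∈ N ∧ ∀ j, i < j → b.repr x j = 0 := by
    intro i x
    simp only [S, Submodule.mem_inf, Submodule.mem_comap, LinearEquiv.coe_coe,
      Finsupp.mem_supported']
    simp
  have hgen : ∀ i, ∃ c ∈ S i, ∀ x ∈ S i, ∃ r : R, b.repr x i = r * b.repr c i := by
    intro i
    let I : Ideal R := (S i).map (b.coord i)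
    obtain ⟨c, hc, hca⟩ := Submodule.IsPrincipal.generator_mem I
    refine ⟨c, hc, fun x hx => ?_⟩
    have hxI : b.coord i x ∈ I := Submodule.mem_map_of_mem hx
    obtain ⟨r, hr⟩ := (Submodule.IsPrincipal.mem_iff_eq_smul_generator I).1 hxI
    refine ⟨r, ?_⟩
    rw [← hca] at hr
    simpa using hr
  choose c hcS hc using hgen
  let J := {i : ι // b.repr (c i) i ≠ 0}
  let v : J → N := fun i => ⟨c i, ((hS _ _).1 (hcS i)).1⟩
  have hli : LinearIndependent R v := by
    rw [linearIndependent_iff]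
    intro l hl
    by_contra hne
    have hsupp : l.support.Nonempty := Finsupp.support_nonempty_iff.2 hne
    obtain ⟨m, hm, hmax⟩ := l.support.exists_max_image (fun j : J => (j : ι)) hsupp
    have h : b.repr ((Finsupp.linearCombination R v l : N) : M) m = 0 := by simp [hl]
    rw [Finsupp.linearCombination_apply, Finsupp.sum] at h
    push_cast at h
    rw [map_sum, Finsupp.finsetSum_apply, Finset.sum_eq_single m] at h
    · simp only [map_smul, Finsupp.smul_apply, smul_eq_mul, mul_eq_zero, v] at h
      exact h.elim (Finsupp.mem_support_iff.1 hm) m.2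
    · intro j hj hjm
      have hlt : (j : ι) < m := lt_of_le_of_ne (hmax j hj) fun e => hjm (Subtype.ext e)
      simp [v, ((hS _ _).1 (hcS j)).2 m hlt]
    · exact fun h' => (h' hm).elim
  have hspan : ∀ i x, x ∈ S i → x ∈ (Submodule.span R (Set.range v)).map N.subtype := by
    intro i
    induction i using WellFoundedLT.induction with
    | ind i ih =>
      intro x hx
      obtain ⟨z, hz, hzS, hzi⟩ : ∃ z ∈ (Submodule.span R (Set.range v)).map N.subtype,
          x - z ∈ S i ∧ b.repr (x - z) i = 0 := by
        obtain ⟨r, hr⟩ := hc i x hx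
        by_cases ha : b.repr (c i) i = 0
        · exact ⟨0, Submodule.zero_mem _, by simpa using hx, by simp [hr, ha]⟩
        · exact ⟨r • c i, Submodule.smul_mem _ r
            ⟨v ⟨i, ha⟩, Submodule.subset_span (Set.mem_range_self _), rfl⟩,
            Submodule.sub_mem _ hx (Submodule.smul_mem _ r (hcS i)), by simp [hr]⟩
      suffices h : x - z ∈ (Submodule.span R (Set.range v)).map N.subtype by
        simpa using Submodule.add_mem _ h hz
      rcases (b.repr (x - z)).support.eq_empty_or_nonempty with he | hne
      · have : x - z = 0 := b.repr.map_eq_zero_iff.1 (Finsupp.support_eq_empty.1 he)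
        rw [this]
        exact Submodule.zero_mem _
      · have hlast := Finset.max'_mem _ hne
        set j := (b.repr (x - z)).support.max' hne
        have hzS' := (hS _ _).1 hzS
        have hji : j < i := by
          by_contra! hij
          rcases hij.eq_or_lt with h | h
          · exact Finsupp.mem_support_iff.1 hlast (h ▸ hzi)
          · exact Finsupp.mem_support_iff.1 hlast (hzS'.2 j h)
        refine ih j hji _ ((hS _ _).2 ⟨hzS'.1, fun k hk => ?_⟩)
        by_contra hk0
        exact absurd (Finset.le_max' _ k (Finsupp.mem_support_iff.2 hk0)) (not_le.2 hk)
  refine Module.Free.of_basis (Module.Basis.mk hli fun x _ => ?_)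
  have hx : (x : M) ∈ (Submodule.span R (Set.range v)).map N.subtype := by
    rcases (b.repr (x : M)).support.eq_empty_or_nonempty with he | hne
    · have : (x : M) = 0 := by simpa using he
      rw [this]
      exact Submodule.zero_mem _
    · refine hspan ((b.repr (x : M)).support.max' hne) x ((hS _ _).2 ⟨x.2, fun k hk => ?_⟩)
      by_contra hk0
      exact absurd (Finset.le_max' _ k (Finsupp.mem_support_iff.2 hk0)) (not_le.2 hk)
  obtain ⟨y, hy, hyx⟩ := hx
  rwa [← Subtype.ext hyx]

/-- A subgroup of a free abelian group is free abelian. -/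
theorem Subgroup.free_additive {A : Type*} [CommGroup A] [Module.Free ℤ (Additive A)]
    (H : Subgroup A) : Module.Free ℤ (Additive H) := by
  let f : Additive H →ₗ[ℤ] Additive A := H.subtype.toAdditive.toIntLinearMap
  have hf : Function.Injective f := fun x y h => H.subtype_injective h
  have := Submodule.free_of_isPrincipalIdealRing (LinearMap.range f)
  exact Module.Free.of_equiv (LinearEquiv.ofInjective f hf).symm

/-- The kernel of a homomorphism into a free abelian group has a complement. -/
theorem MonoidHom.exists_isCompl_ker_of_free {A B : Type*} [CommGroup A] [CommGroup B]
    [Module.Free ℤ (Additive B)] (φ : A →* B) : ∃ H : Subgroup A, IsCompl H φ.ker := by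
  let f : Additive A →ₗ[ℤ] Additive B := φ.toAdditive.toIntLinearMap
  have := Submodule.free_of_isPrincipalIdealRing (LinearMap.range f)
  obtain ⟨s, hs⟩ := f.rangeRestrict.exists_rightInverse_of_surjective f.range_rangeRestrict
  have hsf : ∀ y, f.rangeRestrict (s y) = y := LinearMap.congr_fun hs
  refine ⟨AddSubgroup.toSubgroup' (LinearMap.range s).toAddSubgroup, ?_⟩
  rw [isCompl_iff, Subgroup.disjoint_def, codisjoint_iff, eq_top_iff]
  constructor
  · rintro x ⟨y, hy⟩ hx
    have hfx : f.rangeRestrict (Additive.ofMul x) = 0 := Subtype.ext hx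
    have hy' : s y = Additive.ofMul x := hy
    have hy0 : y = 0 := by rw [← hsf y, hy', hfx]
    rw [hy0, map_zero] at hy'
    exact hy'.symm
  · intro x _
    let z : A := (s (f.rangeRestrict (Additive.ofMul x))).toMul
    have hz : φ z = φ x := congrArg Subtype.val (hsf (f.rangeRestrict (Additive.ofMul x)))
    refine Subgroup.mem_sup.2 ⟨z, ⟨_, rfl⟩, z⁻¹ * x, ?_, mul_inv_cancel_left z x⟩
    rw [MonoidHom.mem_ker, map_mul, map_inv, hz, inv_mul_cancel]

/-- If the units of a field are a product of a torsion group and a free abelian group, then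
the reduced multiplicative group is free abelian. -/
theorem IsRegularField.free_reducedUnits {F : Type*} [Field F] (h : IsRegularField F) :
    Module.Free ℤ (Additive (reducedUnits F)) := by
  obtain ⟨-, T, Fr, hT, hFr, -, hsup⟩ := h
  let g : Fr →* reducedUnits F := (QuotientGroup.mk' (CommGroup.torsion Fˣ)).comp Fr.subtype
  have hinj : Function.Injective g := by
    rw [injective_iff_map_eq_one]
    intro x hx
    have hx' : IsOfFinOrder (x : Fˣ) := (QuotientGroup.eq_one_iff _).1 hx
    obtain ⟨m, hm, hxm⟩ := isOfFinOrder_iff_pow_eq_one.1 hx'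
    have hxm' : (m : ℤ) • Additive.ofMul x = 0 := by
      rw [natCast_zsmul]
      exact congrArg Additive.ofMul (Subtype.ext hxm)
    have hor : (m : ℤ) = 0 ∨ Additive.ofMul x = 0 := smul_eq_zero.1 hxm'
    exact hor.resolve_left (Nat.cast_ne_zero.2 hm.ne')
  have hsurj : Function.Surjective g := by
    intro y
    obtain ⟨x, rfl⟩ := QuotientGroup.mk_surjective y
    obtain ⟨t, ht, z, hz, rfl⟩ := Subgroup.mem_sup.1 (hsup ▸ Subgroup.mem_top x)
    refine ⟨⟨z, hz⟩, ?_⟩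
    have : (t : reducedUnits F) = 1 := (QuotientGroup.eq_one_iff _).2 (hT t ht)
    rw [QuotientGroup.mk_mul, this, one_mul]
    rfl
  exact Module.Free.of_equiv
    (MulEquiv.ofBijective g ⟨hinj, hsurj⟩).toAdditive.toIntLinearEquiv

/-- The endomorphism of the reduced multiplicative group of `F` induced by the norm to `K`. -/
noncomputable def reducedNorm (K F : Type*) [Field K] [Field F] [Algebra K F] :
    reducedUnits F →* reducedUnits F :=
  QuotientGroup.map (CommGroup.torsion Fˣ) (CommGroup.torsion Fˣ)
    ((Units.map (algebraMap K F : K →+* F).toMonoidHom).comp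
      (Units.map (Algebra.norm K : F →* K)))
    fun _ hx => MonoidHom.isOfFinOrder _ hx

theorem reducedNorm_mk {K F : Type*} [Field K] [Field F] [Algebra K F] (x : Fˣ) :
    reducedNorm K F (QuotientGroup.mk' (CommGroup.torsion Fˣ) x) =
      QuotientGroup.mk' (CommGroup.torsion Fˣ) (Units.map (algebraMap K F : K →+* F).toMonoidHom
        (Units.map (Algebra.norm K : F →* K) x)) :=
  rfl

theorem reducedNorm_mem_reducedImage {K F : Type*} [Field K] [Field F] [Algebra K F]
    (y : reducedUnits F) : reducedNorm K F y ∈ reducedImage K F := by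
  obtain ⟨x, rfl⟩ := QuotientGroup.mk'_surjective _ y
  exact Subgroup.mem_map_of_mem _ ⟨_, rfl⟩

theorem reducedNorm_eq_pow_of_mem_reducedImage {K F : Type*} [Field K] [Field F] [Algebra K F]
    {y : reducedUnits F} (hy : y ∈ reducedImage K F) :
    reducedNorm K F y = y ^ Module.finrank K F := by
  obtain ⟨-, ⟨a, rfl⟩, rfl⟩ := hy
  rw [reducedNorm_mk, ← map_pow, ← map_pow]
  congr 2
  ext
  exact Algebra.norm_algebraMap (a : K)

/-- The elements `y` with `y ^ [F : K] = N(y)` are those whose `[F : K]`-th power comes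
from `K`. -/
theorem ker_pow_div_reducedNorm (K F : Type*) [Field K] [Field F] [Algebra K F]
    [FiniteDimensional K F] :
    (powMonoidHom (Module.finrank K F) / reducedNorm K F).ker =
      Subgroup.comap (powMonoidHom (Module.finrank K F)) (reducedImage K F) := by
  ext y
  rw [MonoidHom.mem_ker, MonoidHom.div_apply, div_eq_one, Subgroup.mem_comap,
    powMonoidHom_apply]
  constructor
  · intro h
    rw [h]
    exact reducedNorm_mem_reducedImage y
  · intro h
    have hpow := reducedNorm_eq_pow_of_mem_reducedImage h
    rw [map_pow] at hpow
    exact (pow_left_injective Module.finrank_pos.ne' hpow).symm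

/-- Lemma 2.2: if `[f:k] = n` and `f` is regular, then
`f̄ = F × D` where `F` is a countable free abelian group and
`D = {x ∈ f̄ | x^n ∈ k̄}`. -/
theorem reducedUnits_internal_product
    (K F : Type*) [Field K] [Field F] [Algebra K F] [FiniteDimensional K F]
    (n : ℕ) (hn : Module.finrank K F = n)
    (hreg : IsRegularField F) :
    ∃ Fr : Subgroup (reducedUnits F),
      Countable Fr ∧ Module.Free ℤ (Additive Fr) ∧
      Fr ⊓ Subgroup.comap (powMonoidHom n) (reducedImage K F) = ⊥ ∧
      Fr ⊔ Subgroup.comap (powMonoidHom n) (reducedImage K F) = ⊤ := by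
  have := hreg.free_reducedUnits
  have := hreg.1
  obtain ⟨H, hH⟩ :=
    (powMonoidHom (Module.finrank K F) / reducedNorm K F).exists_isCompl_ker_of_free
  rw [ker_pow_div_reducedNorm, hn] at hH
  have : Countable Fˣ := Units.val_injective.countable
  have : Countable (reducedUnits F) := QuotientGroup.mk_surjective.countable
  exact ⟨H, inferInstance, H.free_additive, hH.inf_eq_bot, hH.sup_eq_top⟩
end
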